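/- arXiv:0904.4425 — 5 statements merged into one kernel-verified Lean document; each statement's English description precedes it below -/
import Mathlib

section
/- Let (R, 𝔪, k) be a Noetherian local ring of prime characteristic p and let M be an Artinian R-module with an injective Frobenius action F. Then the set Γ = {Ann_R(N) : N an R-submodule of M with F(N) ⊆ N} is a finite set of ideals of R. -/
section FrobeniusAction

variable {R M : Type*} [CommRing R] {p : ℕ} [ExpChar R p] [AddCommGroup M] [Module R M]

theorem smul_le_comap_of_le_comap {F : M →ₛₗ[frobenius R p] M} {N : Submodule R M}
    (hN : N ≤ N.comap F) (I : Ideal R) : I • N ≤ (I • N).comap F := by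
  refine Submodule.smul_le.2 fun r hr n hn ↦ ?_
  rw [Submodule.mem_comap, map_smulₛₗ, frobenius_def]
  exact Submodule.smul_mem_smul (I.pow_mem_of_mem hr p (expChar_pos R p)) (hN hn)

theorem inf_le_comap_of_le_comap {F : M →ₛₗ[frobenius R p] M} {N L : Submodule R M}
    (hN : N ≤ N.comap F) (hL : L ≤ L.comap F) : N ⊓ L ≤ (N ⊓ L).comap F :=
  fun _ hx ↦ ⟨hN hx.1, hL hx.2⟩

theorem iSup_le_comap_of_le_comap {F : M →ₛₗ[frobenius R p] M} {ι : Sort*} {N : ι → Submodule R M}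
    (hN : ∀ i, N i ≤ (N i).comap F) : ⨆ i, N i ≤ (⨆ i, N i).comap F :=
  iSup_le fun i ↦ (hN i).trans (Submodule.comap_mono (le_iSup N i))

theorem sup_le_comap_of_le_comap {F : M →ₛₗ[frobenius R p] M} {N L : Submodule R M}
    (hN : N ≤ N.comap F) (hL : L ≤ L.comap F) : N ⊔ L ≤ (N ⊔ L).comap F :=
  sup_le (hN.trans (Submodule.comap_mono le_sup_left))
    (hL.trans (Submodule.comap_mono le_sup_right))

/-- The annihilators of the submodules that are invariant under a Frobenius action. -/
def frobeniusAnnihilators (F : M →ₛₗ[frobenius R p] M) : Set (Ideal R) :=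
  {I | ∃ N : Submodule R M, N ≤ N.comap F ∧ I = N.annihilator}

theorem mem_annihilator_of_mul_self_mem {F : M →ₛₗ[frobenius R p] M}
    (hF : Function.Injective F) (hp : 2 ≤ p) {N : Submodule R M} (hN : N ≤ N.comap F) {r : R}
    (hr : r * r ∈ N.annihilator) : r ∈ N.annihilator := by
  refine Submodule.mem_annihilator.2 fun n hn ↦ hF ?_
  rw [map_smulₛₗ, frobenius_def, map_zero, ← pow_sub_mul_pow r hp, pow_two, mul_smul,
    Submodule.mem_annihilator.1 hr _ (hN hn), smul_zero]

/-- An annihilator of an invariant submodule that avoids `x` lies in a prime one avoiding `x`. -/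
theorem exists_isPrime_mem_frobeniusAnnihilators [IsNoetherianRing R]
    {F : M →ₛₗ[frobenius R p] M} (hF : Function.Injective F) (hp : 2 ≤ p) {I : Ideal R}
    (hI : I ∈ frobeniusAnnihilators F) {x : R} (hx : x ∉ I) :
    ∃ Q ∈ frobeniusAnnihilators F, Q.IsPrime ∧ I ≤ Q ∧ x ∉ Q := by
  obtain ⟨Q, ⟨⟨N, hN, rfl⟩, hIQ, hxQ⟩, hmax⟩ := set_has_maximal_iff_noetherian.2 ‹_›
    {J : Ideal R | J ∈ frobeniusAnnihilators F ∧ I ≤ J ∧ x ∉ J} ⟨I, hI, le_rfl, hx⟩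
  have mem_span {a r : R} : r ∈ (Ideal.span {a} • N).annihilator ↔ r * a ∈ N.annihilator := by
    simp [Submodule.mem_annihilator, Submodule.ideal_span_singleton_smul,
      Submodule.mem_smul_pointwise_iff_exists, mul_smul]
  have le_span (a : R) : N.annihilator ≤ (Ideal.span {a} • N).annihilator :=
    Submodule.annihilator_mono Submodule.smul_le_right
  have mem_of_notMem {a r : R} (hxa : x * a ∉ N.annihilator) (hra : r * a ∈ N.annihilator) :
      r ∈ N.annihilator := by
    by_contra hr
    refine hmax (Ideal.span {a} • N).annihilator
      ⟨⟨_, smul_le_comap_of_le_comap hN _, rfl⟩, hIQ.trans (le_span a), mt mem_span.1 hxa⟩ ?_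
    exact lt_of_le_of_ne (le_span a) fun h ↦ hr (h ▸ mem_span.2 hra)
  have hxx {r : R} (h : r * x ∈ N.annihilator) : r ∈ N.annihilator :=
    mem_of_notMem (mt (mem_annihilator_of_mul_self_mem hF hp hN) hxQ) h
  refine ⟨_, ⟨N, hN, rfl⟩, ⟨fun h ↦ hxQ (h ▸ Submodule.mem_top), fun {a b} hab ↦ ?_⟩, hIQ, hxQ⟩
  by_contra! h
  exact h.1 (mem_of_notMem (fun hxb ↦ h.2 (hxx (mul_comm x b ▸ hxb))) hab)

theorem finite_isPrime_mem_frobeniusAnnihilators_of_finite [IsNoetherianRing R] [IsArtinian R M]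
    {F : M →ₛₗ[frobenius R p] M} (hF : Function.Injective F) (hp : 2 ≤ p) {A : Set (Ideal R)}
    (hA : A.Finite) :
    {P ∈ frobeniusAnnihilators F | P.IsPrime ∧ (∀ Q ∈ A, ¬ Q ≤ P) ∧
      ∀ Q ∈ frobeniusAnnihilators F, Q.IsPrime → P < Q → Q ∈ A}.Finite := by
  by_contra hinf
  have : Infinite _ := Set.infinite_coe_iff.2 hinf
  let e := Infinite.natEmbedding {P ∈ frobeniusAnnihilators F | P.IsPrime ∧ (∀ Q ∈ A, ¬ Q ≤ P) ∧
      ∀ Q ∈ frobeniusAnnihilators F, Q.IsPrime → P < Q → Q ∈ A}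
  have he (i) := (e i).2
  choose hmem hprime hA' hmax using he
  choose N hN hPN using hmem
  have hanti {i j : ℕ} (hij : i ≠ j) : ¬ (N i).annihilator ≤ (N j).annihilator := by
    rw [← hPN, ← hPN]
    intro hle
    have hlt : (e i : Ideal R) < e j :=
      lt_of_le_of_ne hle fun h ↦ hij (e.injective (Subtype.ext h))
    exact hA' j _ (hmax i _ ⟨_, hN j, hPN j⟩ (hprime j) hlt) le_rfl
  set b : Ideal R := hA.toFinset.inf id with hb
  have hbA {Q : Ideal R} (hQ : Q ∈ A) : b ≤ Q := Finset.inf_le (f := id) (hA.mem_toFinset.2 hQ)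
  have hbN (i : ℕ) : ¬ b ≤ (N i).annihilator := by
    rw [← hPN, hb, (hprime i).inf_le']
    rintro ⟨Q, hQ, hle⟩
    exact hA' i Q (hA.mem_toFinset.1 hQ) hle
  -- the largest invariant submodule killed by `b`
  let L : Submodule R M :=
    ⨆ K : {K : Submodule R M // K ≤ K.comap F ∧ b ≤ K.annihilator}, (K : Submodule R M)
  have hL : L ≤ L.comap F := iSup_le_comap_of_le_comap fun K ↦ K.2.1
  have hbL : b ≤ L.annihilator := by
    rw [Submodule.annihilator_iSup]
    exact le_iInf fun K ↦ K.2.2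
  have le_L {K : Submodule R M} (hK : K ≤ K.comap F) (hbK : b ≤ K.annihilator) : K ≤ L :=
    le_iSup (fun K : {K : Submodule R M // K ≤ K.comap F ∧ b ≤ K.annihilator} ↦
      (K : Submodule R M)) ⟨K, hK, hbK⟩
  obtain ⟨n, hn⟩ := IsArtinian.monotone_stabilizes (R := R) (M := M)
    ⟨fun n ↦ OrderDual.toDual (⨆ i : {i // n ≤ i}, L ⊔ N i), fun m n hmn ↦
      OrderDual.toDual_le_toDual.2 (iSup_le fun i ↦
        le_iSup (fun i : {i // m ≤ i} ↦ L ⊔ N i) ⟨i, hmn.trans i.2⟩)⟩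
  have hle : N n ≤ ⨆ i : {i // n + 1 ≤ i}, L ⊔ N i :=
    (le_sup_right.trans (le_iSup (fun i : {i // n ≤ i} ↦ L ⊔ N i) ⟨n, le_rfl⟩)).trans
      (OrderDual.toDual.injective (hn (n + 1) n.le_succ)).le
  refine hbN n (hbL.trans (Submodule.annihilator_mono fun x hx ↦ ?_))
  obtain ⟨s, hs⟩ := Submodule.mem_iSup_iff_exists_finset.1 (hle hx)
  set T : Submodule R M := ⨆ i ∈ s, L ⊔ N i with hT
  have hTinv : T ≤ T.comap F := iSup_le_comap_of_le_comap fun i ↦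
    iSup_le_comap_of_le_comap fun _ ↦ sup_le_comap_of_le_comap hL (hN i)
  have hK := inf_le_comap_of_le_comap (hN n) hTinv
  refine le_L hK ?_ ⟨hx, hs⟩
  have hnot : ¬ (N n ⊓ T).annihilator ≤ (N n).annihilator := by
    intro h
    have hTa : b ⊓ s.inf (fun i ↦ (N i).annihilator) ≤ T.annihilator := by
      simp only [hT, Submodule.annihilator_iSup, Submodule.annihilator_sup]
      exact le_iInf₂ fun i hi ↦ inf_le_inf hbL (Finset.inf_le hi)
    have := (hTa.trans (Submodule.annihilator_mono inf_le_right)).trans h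
    have hpr : (N n).annihilator.IsPrime := hPN n ▸ hprime n
    rcases hpr.inf_le.1 this with h | h
    · exact hbN n h
    · obtain ⟨i, -, hi⟩ := hpr.inf_le'.1 h
      exact hanti (Nat.lt_of_succ_le i.2).ne' hi
  intro y hy
  by_contra hyK
  obtain ⟨Q, hQ, hQp, hKQ, hyQ⟩ :=
    exists_isPrime_mem_frobeniusAnnihilators hF hp ⟨_, hK, rfl⟩ hyK
  refine hyQ (hbA (hmax n Q hQ hQp (lt_of_le_of_ne ?_ ?_)) hy)
  · exact (hPN n).le.trans ((Submodule.annihilator_mono inf_le_left).trans hKQ)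
  · rintro h
    exact hnot (hKQ.trans (h.symm.trans (hPN n)).le)

theorem finite_isPrime_mem_frobeniusAnnihilators [IsNoetherianRing R] [IsLocalRing R]
    [IsArtinian R M] {F : M →ₛₗ[frobenius R p] M} (hF : Function.Injective F) (hp : 2 ≤ p) :
    {P ∈ frobeniusAnnihilators F | P.IsPrime}.Finite := by
  let m := (IsLocalRing.maximalIdeal R).height.toNat
  have hlt {P Q : Ideal R} (hP : P.IsPrime) (hQ : Q.IsPrime) (h : P < Q) :
      P.height.toNat < Q.height.toNat :=
    Nat.cast_lt.1 <| by
      rw [ENat.natCast_toNat (Ideal.height_ne_top hP.ne_top),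
        ENat.natCast_toNat (Ideal.height_ne_top hQ.ne_top)]
      exact Ideal.height_strict_mono_of_isPrime h
  have hle {P : Ideal R} (hP : P.IsPrime) : P.height.toNat ≤ m :=
    ENat.toNat_le_toNat (Ideal.height_mono (IsLocalRing.le_maximalIdeal hP.ne_top))
      (Ideal.height_ne_top (IsLocalRing.maximalIdeal.isMaximal R).ne_top)
  have key (k : ℕ) :
      {P ∈ frobeniusAnnihilators F | P.IsPrime ∧ m < P.height.toNat + k}.Finite := by
    induction k with
    | zero =>
      exact Set.finite_empty.subset fun P hP ↦ (hP.2.2.trans_le (hle hP.2.1)).false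
    | succ k ih =>
      refine (ih.union (finite_isPrime_mem_frobeniusAnnihilators_of_finite hF hp ih)).subset ?_
      rintro P ⟨hP, hPp, hPk⟩
      by_cases h : m < P.height.toNat + k
      · exact .inl ⟨hP, hPp, h⟩
      refine .inr ⟨hP, hPp, ?_, fun Q hQ hQp hPQ ↦ ⟨hQ, hQp, ?_⟩⟩
      · rintro Q ⟨-, hQp, hQk⟩ hQP
        rcases hQP.eq_or_lt with rfl | hQP
        · exact h hQk
        · have := hlt hQp hPp hQP
          lia
      · have := hlt hPp hQp hPQ
        lia
  exact (key (m + 1)).subset fun P hP ↦ ⟨hP.1, hP.2, by lia⟩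

theorem finite_frobeniusAnnihilators [IsNoetherianRing R] [IsLocalRing R]
    [IsArtinian R M] {F : M →ₛₗ[frobenius R p] M} (hF : Function.Injective F) (hp : 2 ≤ p) :
    (frobeniusAnnihilators F).Finite := by
  refine ((finite_isPrime_mem_frobeniusAnnihilators hF hp).finite_subsets.image sInf).subset ?_
  intro I hI
  refine ⟨{P ∈ frobeniusAnnihilators F | P.IsPrime ∧ I ≤ P}, fun P hP ↦ ⟨hP.1, hP.2.1⟩,
    le_antisymm (fun x hx ↦ ?_) (le_sInf fun P hP ↦ hP.2.2)⟩
  by_contra hxI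
  obtain ⟨Q, hQ, hQp, hIQ, hxQ⟩ := exists_isPrime_mem_frobeniusAnnihilators hF hp hI hxI
  exact hxQ (Submodule.mem_sInf.1 hx Q ⟨hQ, hQp, hIQ⟩)

end FrobeniusAction


/-- **Sharp; Enescu–Hochster (finiteness).** Let `(R, 𝔪, k)` be a Noetherian local ring of
prime characteristic `p` and `M` an Artinian `R`-module with an injective Frobenius action `F`.
Then the set `Γ` of annihilators of `F`-invariant submodules of `M` is a finite set of ideals. -/
theorem annihilators_of_frobenius_invariant_submodules_finite
    {R M : Type*} [CommRing R] [IsLocalRing R] [IsNoetherianRing R]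
    (p : ℕ) [Fact p.Prime] [CharP R p]
    [AddCommGroup M] [Module R M] [IsArtinian R M]
    (F : M → M)
    (hadd : ∀ x y : M, F (x + y) = F x + F y)
    (hsmul : ∀ (r : R) (m : M), F (r • m) = r ^ p • F m)
    (hinj : Function.Injective F) :
    {I : Ideal R | ∃ N : Submodule R M, (∀ x ∈ N, F x ∈ N) ∧ I = N.annihilator}.Finite := by
  have : ExpChar R p := .prime Fact.out
  let G : M →ₛₗ[frobenius R p] M := { toFun := F, map_add' := hadd, map_smul' := hsmul }
  exact finite_frobeniusAnnihilators (F := G) hinj (Fact.out : p.Prime).two_le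
end

section
/- Let (R, 𝔪, k) be a Noetherian local ring of prime characteristic p containing a coefficient field k, and let M be an Artinian R-module with an injective Frobenius action F. Then M is F-stable if and only if the stable part M_s is nonzero. -/
/-- The socle of a module `M` over a local ring `R`:
the set of elements killed by the maximal ideal. -/
def Socle (R M : Type*) [CommRing R] [IsLocalRing R] [AddCommGroup M] [Module R M] : Set M :=
  {x : M | ∀ r ∈ IsLocalRing.maximalIdeal R, r • x = 0}

/-- The `K`-span of a subset `S` of an `R`-module `M`, where `K` acts on `M` through a ring
homomorphism `ι : K →+* R` (e.g. the inclusion of a coefficient field): the set of finite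
`K`-linear combinations of elements of `S`. -/
def kSpan {K R M : Type*} [Field K] [CommRing R] [AddCommGroup M] [Module R M]
    (ι : K →+* R) (S : Set M) : Set M :=
  {m : M | ∃ (n : ℕ) (c : Fin n → K) (s : Fin n → M),
    (∀ i, s i ∈ S) ∧ m = ∑ i, ι (c i) • s i}

/-- The Hartshorne–Speiser stable part of a module `M` with Frobenius action `F`, relative to a
coefficient field `ι : K →+* R`: the intersection over `j ≥ 1` of the `K`-spans of the images
`F^j(M)`. -/
def stablePart {K R M : Type*} [Field K] [CommRing R] [AddCommGroup M] [Module R M]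
    (ι : K →+* R) (F : M → M) : Set M :=
  ⋂ j ∈ {j : ℕ | 1 ≤ j}, kSpan ι (Set.range F^[j])

open TensorProduct

/-- A dual form of the Hilbert basis theorem: a module all of whose elements are killed by a power
of `x` is Artinian as soon as the kernel of multiplication by `x` is. -/
theorem isArtinian_of_isArtinian_ker_lsmul {A P : Type*} [CommRing A] [AddCommGroup P] [Module A P]
    (x : A) (htors : ∀ w : P, ∃ n : ℕ, x ^ n • w = 0)
    [IsArtinian A (LinearMap.ker (LinearMap.lsmul A P x))] : IsArtinian A P := by
  rw [← monotone_stabilizes_iff_artinian]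
  intro f
  have hf : ∀ {m n : ℕ}, m ≤ n → ∀ {w : P}, w ∈ (f n).ofDual → w ∈ (f m).ofDual :=
    fun h _ hw ↦ f.monotone h hw
  -- `g i n` consists of the elements of the form `x ^ i • w`, killed by `x`, with `w ∈ f n`.
  let g : ℕ → ℕ → Submodule A (LinearMap.ker (LinearMap.lsmul A P x)) := fun i n ↦
    ((f n).ofDual.map (LinearMap.lsmul A P (x ^ i))).comap (Submodule.subtype _)
  have mem_g (i n : ℕ) (z) : z ∈ g i n ↔ ∃ w ∈ (f n).ofDual, x ^ i • w = z.1 := by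
    simp [g]
  have g_anti {i j m n : ℕ} (hij : i ≤ j) (hmn : m ≤ n) : g j n ≤ g i m := by
    intro z hz
    obtain ⟨w, hw, h⟩ := (mem_g _ _ _).1 hz
    refine (mem_g _ _ _).2 ⟨x ^ (j - i) • w, Submodule.smul_mem _ _ (hf hmn hw), ?_⟩
    rw [smul_smul, ← pow_add, Nat.add_sub_cancel' hij, h]
  obtain ⟨N, hN⟩ := IsArtinian.monotone_stabilizes
    (⟨fun n ↦ OrderDual.toDual (g n n), fun a b h ↦ g_anti h h⟩ : ℕ →o (Submodule A _)ᵒᵈ)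
  have hN' (n : ℕ) (h : N ≤ n) : g N N = g n n := hN n h
  have hrow (i : ℕ) : ∃ n, ∀ m, n ≤ m → g i n = g i m :=
    IsArtinian.monotone_stabilizes
      (⟨fun n ↦ OrderDual.toDual (g i n), fun a b h ↦ g_anti le_rfl h⟩ : ℕ →o (Submodule A _)ᵒᵈ)
  choose r hr using hrow
  let B := N + ∑ i ∈ Finset.range N, r i
  have hB (i n : ℕ) (hn : B ≤ n) : g i B ≤ g i n := by
    by_cases hi : i < N
    · have hle : r i ≤ B :=
        (Finset.single_le_sum (f := r) (fun _ _ ↦ Nat.zero_le _) (Finset.mem_range.2 hi)).trans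
          (Nat.le_add_left _ _)
      rw [← hr i B hle, ← hr i n (hle.trans hn)]
    · have hNB : N ≤ B := Nat.le_add_right _ _
      calc g i B ≤ g N N := g_anti (not_lt.1 hi) hNB
        _ = g (max i n) (max i n) := hN' _ ((hNB.trans hn).trans (le_max_right _ _))
        _ ≤ g i n := g_anti (le_max_left _ _) (le_max_right _ _)
  refine ⟨B, fun n hn ↦ le_antisymm (f.monotone hn) ?_⟩
  have key (i : ℕ) : ∀ w ∈ (f B).ofDual, x ^ i • w = 0 → w ∈ (f n).ofDual := by
    induction i with
    | zero => intro w _ h; simp_all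
    | succ i ih =>
      intro w hw h
      have hz : x ^ i • w ∈ LinearMap.ker (LinearMap.lsmul A P x) := by
        rw [LinearMap.mem_ker, LinearMap.lsmul_apply, smul_smul, ← pow_succ', h]
      obtain ⟨w', hw', h'⟩ := (mem_g _ _ _).1 (hB i n hn ((mem_g i B ⟨_, hz⟩).2 ⟨w, hw, rfl⟩))
      have := ih (w - w') (Submodule.sub_mem _ hw (hf hn hw')) (by rw [smul_sub, h', sub_self])
      simpa using Submodule.add_mem _ this hw'
  intro w hw
  obtain ⟨i, hi⟩ := htors w
  exact key i w hw hi

section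

variable {R : Type*} [CommRing R] [IsLocalRing R]

theorem exists_maximalIdeal_pow_smul_eq_zero [IsNoetherianRing R] {Q : Type*} [AddCommGroup Q]
    [Module R Q] [IsArtinian R Q] (q : Q) :
    ∃ n : ℕ, ∀ r ∈ IsLocalRing.maximalIdeal R ^ n, r • q = 0 := by
  let I := IsLocalRing.maximalIdeal R
  obtain ⟨n, hn⟩ := IsArtinian.monotone_stabilizes
    (⟨fun n ↦ OrderDual.toDual (I ^ n • Submodule.span R {q}),
      fun a b h ↦ Submodule.smul_mono_left (Ideal.pow_le_pow_right h)⟩ : ℕ →o (Submodule R Q)ᵒᵈ)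
  have h : I ^ n • Submodule.span R {q} = I ^ (n + 1) • Submodule.span R {q} := hn _ n.le_succ
  refine ⟨n, fun r hr ↦ ?_⟩
  have hbot : I ^ n • Submodule.span R {q} = ⊥ := by
    refine Submodule.eq_bot_of_le_smul_of_le_jacobson_bot I _ ?_ ?_
      (IsLocalRing.jacobson_eq_maximalIdeal ⊥ bot_ne_top).ge
    · exact Submodule.FG.smul (IsNoetherian.noetherian _) (Submodule.fg_span_singleton q)
    · rw [← mul_smul, ← pow_succ', ← h]
  rw [← Submodule.mem_bot R, ← hbot]
  exact Submodule.smul_mem_smul hr (Submodule.mem_span_singleton_self q)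

variable {A : Type*} [CommRing A] [Algebra R A]

/-- Base change of an Artinian module killed by the maximal ideal. -/
theorem isArtinian_tensorProduct_of_maximalIdeal_smul_eq_zero
    [IsArtinianRing (A ⧸ (IsLocalRing.maximalIdeal R).map (algebraMap R A))]
    {Q : Type*} [AddCommGroup Q] [Module R Q] [IsArtinian R Q]
    (hQ : ∀ r ∈ IsLocalRing.maximalIdeal R, ∀ q : Q, r • q = 0) : IsArtinian A (A ⊗[R] Q) := by
  have hQt : Module.IsTorsionBySet R Q (IsLocalRing.maximalIdeal R) := fun q r ↦ hQ r r.2 q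
  have : Module.Finite R Q := by
    let _ : Module (IsLocalRing.ResidueField R) Q := hQt.module
    have : IsScalarTower R (IsLocalRing.ResidueField R) Q := hQt.isScalarTower
    have : IsArtinian (IsLocalRing.ResidueField R) Q := isArtinian_of_tower R inferInstance
    have : IsNoetherian (IsLocalRing.ResidueField R) Q :=
      IsSemiprimaryRing.isNoetherian_iff_isArtinian.2 inferInstance
    exact Module.Finite.trans (IsLocalRing.ResidueField R) Q
  let J := (IsLocalRing.maximalIdeal R).map (algebraMap R A)
  have ht : Module.IsTorsionBySet A (A ⊗[R] Q) J := by
    refine (Module.isTorsionBySet_iff_is_torsion_by_span _).1 ?_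
    rintro w ⟨_, r, hr, rfl⟩
    change algebraMap R A r • w = 0
    rw [algebraMap_smul]
    induction w with
    | zero => simp
    | tmul a q => rw [← TensorProduct.tmul_smul, hQ r hr, TensorProduct.tmul_zero]
    | add u v hu hv => rw [smul_add, hu, hv, add_zero]
  let _ : Module (A ⧸ J) (A ⊗[R] Q) := ht.module
  have : IsScalarTower A (A ⧸ J) (A ⊗[R] Q) := ht.isScalarTower
  have : Module.Finite (A ⧸ J) (A ⊗[R] Q) := Module.Finite.of_restrictScalars_finite A _ _
  have : IsArtinian (A ⧸ J) (A ⊗[R] Q) := inferInstance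
  exact isArtinian_of_surjective_algebraMap (S := A) (R := A ⧸ J) Ideal.Quotient.mk_surjective

theorem isArtinian_tensorProduct_of_list [IsNoetherianRing R] [Module.Flat R A]
    [IsArtinianRing (A ⧸ (IsLocalRing.maximalIdeal R).map (algebraMap R A))] (l : List R)
    (hl : ∀ x ∈ l, x ∈ IsLocalRing.maximalIdeal R)
    {Q : Type*} [AddCommGroup Q] [Module R Q] [IsArtinian R Q]
    (hQ : ∀ q : Q, (∀ x ∈ l, x • q = 0) → ∀ r ∈ IsLocalRing.maximalIdeal R, r • q = 0) :
    IsArtinian A (A ⊗[R] Q) := by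
  induction l generalizing Q with
  | nil =>
    exact isArtinian_tensorProduct_of_maximalIdeal_smul_eq_zero fun r hr q ↦ hQ q (by simp) r hr
  | cons x l ih =>
    let f := LinearMap.lsmul R Q x
    have hker : IsArtinian A (A ⊗[R] LinearMap.ker f) := by
      refine ih (fun y hy ↦ hl y (List.mem_cons_of_mem _ hy)) fun q hq r hr ↦ Subtype.ext ?_
      refine hQ q ?_ r hr
      rintro y hy
      rcases List.mem_cons.1 hy with rfl | hy
      · exact q.2
      · exact congrArg Subtype.val (hq y hy)
    have hexact := Module.Flat.lTensor_exact A (LinearMap.exact_subtype_ker_map f)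
    let φ : A ⊗[R] LinearMap.ker f →ₗ[A] A ⊗[R] Q := (LinearMap.ker f).subtype.baseChange A
    have hφ : LinearMap.ker (LinearMap.lsmul A (A ⊗[R] Q) (algebraMap R A x)) =
        LinearMap.range φ := by
      ext w
      have hw : f.lTensor A w = algebraMap R A x • w := by
        rw [algebraMap_smul]
        induction w with
        | zero => simp
        | tmul a q => simp [f]
        | add u v hu hv => rw [map_add, hu, hv, smul_add]
      rw [LinearMap.mem_ker, LinearMap.lsmul_apply, ← hw]
      exact hexact w
    have : IsArtinian A (LinearMap.ker (LinearMap.lsmul A (A ⊗[R] Q) (algebraMap R A x))) := by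
      rw [hφ]; infer_instance
    refine isArtinian_of_isArtinian_ker_lsmul (algebraMap R A x) fun w ↦ ?_
    simp_rw [← map_pow, algebraMap_smul]
    induction w with
    | zero => exact ⟨0, smul_zero _⟩
    | tmul a q =>
      obtain ⟨n, hn⟩ := exists_maximalIdeal_pow_smul_eq_zero (R := R) q
      exact ⟨n, by rw [← TensorProduct.tmul_smul,
        hn _ (Ideal.pow_mem_pow (hl x List.mem_cons_self) n), TensorProduct.tmul_zero]⟩
    | add u v hu hv =>
      obtain ⟨m, hm⟩ := hu
      obtain ⟨n, hn⟩ := hv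
      exact ⟨m + n, by rw [smul_add, pow_add, mul_smul, mul_smul, hn, smul_zero, smul_comm, hm,
        smul_zero, add_zero]⟩

/-- Base change preserves Artinian modules along a flat extension with Artinian closed fibre. -/
theorem isArtinian_tensorProduct [IsNoetherianRing R] [Module.Flat R A]
    [IsArtinianRing (A ⧸ (IsLocalRing.maximalIdeal R).map (algebraMap R A))]
    {Q : Type*} [AddCommGroup Q] [Module R Q] [IsArtinian R Q] :
    IsArtinian A (A ⊗[R] Q) := by
  obtain ⟨s, hs⟩ := IsNoetherian.noetherian (IsLocalRing.maximalIdeal R)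
  refine isArtinian_tensorProduct_of_list s.toList (fun x hx ↦ ?_) fun q hq r hr ↦ ?_
  · rw [← hs]; exact Submodule.subset_span (by simpa using hx)
  · have : IsLocalRing.maximalIdeal R ≤ LinearMap.ker (LinearMap.toSpanSingleton R Q q) := by
      rw [← hs, Submodule.span_le]
      exact fun x hx ↦ hq x (by simpa using hx)
    exact this hr

end

section Frobenius

variable {R M : Type*} [CommRing R] [AddCommGroup M] [Module R M] {p : ℕ}

theorem iterate_smul_of_semilinear {F : M → M} (hsmul : ∀ (r : R) (m : M), F (r • m) = r ^ p • F m)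
    (e : ℕ) (r : R) (m : M) : F^[e] (r • m) = r ^ p ^ e • F^[e] m := by
  induction e with
  | zero => simp
  | succ e ih =>
    rw [Function.iterate_succ_apply', ih, hsmul, ← pow_mul, ← pow_succ,
      Function.iterate_succ_apply']

/-- The base change along `R → A` of a Frobenius action `F`, given by `a ⊗ m ↦ a ^ p ⊗ F m`. -/
noncomputable def frobeniusBaseChange (A : Type*) [CommRing A] [Algebra R A] [Fact p.Prime]
    [CharP A p] (F : M →+ M) (hsmul : ∀ (r : R) (m : M), F (r • m) = r ^ p • F m) :
    A ⊗[R] M →+ A ⊗[R] M :=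
  TensorProduct.liftAddHom
    (AddMonoidHom.mk' (fun a ↦ AddMonoidHom.mk' (fun m ↦ (a ^ p) ⊗ₜ[R] F m)
        fun x y ↦ by rw [map_add, TensorProduct.tmul_add])
      fun a b ↦ by
        ext m
        simp [add_pow_char, TensorProduct.add_tmul])
    fun r a m ↦ by simp [hsmul, smul_pow, TensorProduct.smul_tmul]

section BaseChange

variable {A : Type*} [CommRing A] [Algebra R A] [Fact p.Prime] [CharP A p] (F : M →+ M)
  (hsmul : ∀ (r : R) (m : M), F (r • m) = r ^ p • F m)

theorem frobeniusBaseChange_tmul (a : A) (m : M) :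
    frobeniusBaseChange A F hsmul (a ⊗ₜ m) = (a ^ p) ⊗ₜ F m := by
  simp [frobeniusBaseChange]

theorem frobeniusBaseChange_iterate_tmul (e : ℕ) (a : A) (m : M) :
    (frobeniusBaseChange A F hsmul)^[e] (a ⊗ₜ m) = (a ^ p ^ e) ⊗ₜ F^[e] m := by
  induction e with
  | zero => simp
  | succ e ih =>
    rw [Function.iterate_succ_apply', ih, frobeniusBaseChange_tmul, ← pow_mul, ← pow_succ,
      Function.iterate_succ_apply']

theorem frobeniusBaseChange_smul (a : A) (w : A ⊗[R] M) :
    frobeniusBaseChange A F hsmul (a • w) = a ^ p • frobeniusBaseChange A F hsmul w := by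
  induction w with
  | zero => simp
  | tmul b m => simp [TensorProduct.smul_tmul', frobeniusBaseChange_tmul, mul_pow]
  | add u v hu hv => rw [smul_add, map_add, hu, hv, map_add, smul_add]

/-- If every element of `A` has a `p ^ g`-th power coming from `R`, then every element of `A ⊗ M`
is mapped into `M` by an iterate of the Frobenius action. -/
theorem exists_frobeniusBaseChange_iterate_eq
    (hA : ∀ a : A, ∃ (g : ℕ) (r : R), a ^ p ^ g = algebraMap R A r) (w : A ⊗[R] M) :
    ∃ (g : ℕ) (x : M), (frobeniusBaseChange A F hsmul)^[g] w = 1 ⊗ₜ x := by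
  have hone (e : ℕ) (x : M) :
      (frobeniusBaseChange A F hsmul)^[e] (1 ⊗ₜ x) = 1 ⊗ₜ F^[e] x := by
    rw [frobeniusBaseChange_iterate_tmul, one_pow]
  induction w with
  | zero => exact ⟨0, 0, by simp⟩
  | tmul a m =>
    obtain ⟨g, r, h⟩ := hA a
    refine ⟨g, r • F^[g] m, ?_⟩
    rw [frobeniusBaseChange_iterate_tmul, h, Algebra.algebraMap_eq_smul_one,
      TensorProduct.smul_tmul]
  | add u v hu hv =>
    obtain ⟨g, x, hx⟩ := hu
    obtain ⟨h, y, hy⟩ := hv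
    refine ⟨g + h, F^[h] x + F^[g] y, ?_⟩
    rw [iterate_map_add, TensorProduct.tmul_add, ← hone, ← hone, ← hx, ← hy,
      ← Function.iterate_add_apply, ← Function.iterate_add_apply, add_comm h g]

end BaseChange

/-- The elements whose image under the `e`-th iterate of a `p`-semilinear endomorphism `Φ` is
multiplied by an ideal `J` into the `Φ`-nilpotent elements. -/
def preNilSocle {A P : Type*} [CommRing A] [AddCommGroup P] [Module A P] (J : Set A)
    (Φ : P →+ P) (hΦ : ∀ (a : A) (w : P), Φ (a • w) = a ^ p • Φ w) (e : ℕ) : Submodule A P where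
  carrier := {w | ∀ r ∈ J, ∃ g, Φ^[g] (r • Φ^[e] w) = 0}
  zero_mem' r _ := ⟨0, by simp⟩
  add_mem' {u v} hu hv r hr := by
    obtain ⟨g, hg⟩ := hu r hr
    obtain ⟨h, hh⟩ := hv r hr
    refine ⟨g + h, ?_⟩
    rw [iterate_map_add, smul_add, iterate_map_add, Function.iterate_add_apply _ g h (r • Φ^[e] v),
      hh, iterate_map_zero, add_comm g h, Function.iterate_add_apply, hg, iterate_map_zero,
      add_zero]
  smul_mem' a w hw r hr := by
    obtain ⟨g, hg⟩ := hw r hr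
    refine ⟨g, ?_⟩
    rw [iterate_smul_of_semilinear hΦ e, smul_comm, iterate_smul_of_semilinear hΦ g, hg, smul_zero]

theorem preNilSocle_succ_le {A P : Type*} [CommRing A] [AddCommGroup P] [Module A P] (hp : p ≠ 0)
    (J : Set A) (Φ : P →+ P) (hΦ : ∀ (a : A) (w : P), Φ (a • w) = a ^ p • Φ w) (e : ℕ) :
    preNilSocle J Φ hΦ (e + 1) ≤ preNilSocle J Φ hΦ e := by
  intro w hw r hr
  obtain ⟨g, hg⟩ := hw r hr
  refine ⟨g + 1, ?_⟩
  rw [Function.iterate_succ_apply, hΦ, ← Function.iterate_succ_apply' (f := Φ),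
    ← Nat.sub_add_cancel (Nat.one_le_iff_ne_zero.2 hp), pow_succ, mul_smul,
    iterate_smul_of_semilinear hΦ, hg, smul_zero]

/-- An abstract form of the implication from a nonzero stable part to stability, given a suitable
faithfully flat perfection `A` of `R`. -/
theorem exists_forall_smul_iterate_eq_zero {A : Type*} [CommRing A] [Algebra R A]
    [Module.FaithfullyFlat R A] [Fact p.Prime] [CharP A p] [IsLocalRing R] [IsNoetherianRing R]
    [IsArtinianRing (A ⧸ (IsLocalRing.maximalIdeal R).map (algebraMap R A))] [IsArtinian R M]
    (hA : ∀ a : A, ∃ (g : ℕ) (r : R), a ^ p ^ g = algebraMap R A r)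
    (F : M →+ M) (hsmul : ∀ (r : R) (m : M), F (r • m) = r ^ p • F m)
    (hinj : Function.Injective F) {y : M} (hy0 : y ≠ 0)
    (hy : ∀ j, 1 ≤ j → ∃ w : A ⊗[R] M, (frobeniusBaseChange A F hsmul)^[j] w = 1 ⊗ₜ y) :
    ∃ x : M, x ≠ 0 ∧ ∀ e, ∀ r ∈ IsLocalRing.maximalIdeal R, r • F^[e] x = 0 := by
  have hp : p.Prime := Fact.out
  have hMinj : ∀ x : M, (1 : A) ⊗ₜ[R] x = 0 → x = 0 := fun x hx ↦
    Module.FaithfullyFlat.tensorProduct_mk_injective (A := R) (B := A) M (by simpa using hx)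
  have hFinj (g : ℕ) (x : M) (h : F^[g] x = 0) : x = 0 :=
    hinj.iterate g (h.trans (iterate_map_zero F g).symm)
  have : IsArtinian A (A ⊗[R] M) := isArtinian_tensorProduct
  set Φ := frobeniusBaseChange A F hsmul with hΦdef
  have hΦ : ∀ (a : A) (w : A ⊗[R] M), Φ (a • w) = a ^ p • Φ w := frobeniusBaseChange_smul F hsmul
  have hone (g : ℕ) (x : M) : Φ^[g] (1 ⊗ₜ x) = 1 ⊗ₜ F^[g] x := by
    rw [hΦdef, frobeniusBaseChange_iterate_tmul, one_pow]
  let J : Set A := algebraMap R A '' IsLocalRing.maximalIdeal R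
  have hanti : Antitone (preNilSocle J Φ hΦ) :=
    antitone_nat_of_succ_le (preNilSocle_succ_le hp.ne_zero J Φ hΦ)
  obtain ⟨N, hN⟩ := IsArtinian.monotone_stabilizes
    (⟨fun e ↦ OrderDual.toDual (preNilSocle J Φ hΦ e), hanti⟩ : ℕ →o (Submodule A _)ᵒᵈ)
  have hN' (e : ℕ) : preNilSocle J Φ hΦ N ≤ preNilSocle J Φ hΦ e :=
    (le_total e N).elim (fun h ↦ hanti h) fun h ↦ le_of_eq (hN e h)
  obtain ⟨n, hn⟩ := exists_maximalIdeal_pow_smul_eq_zero (R := R) y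
  obtain ⟨w, hw⟩ := hy (N + n + 1) (Nat.le_add_left _ _)
  have hwmem : w ∈ preNilSocle J Φ hΦ N := by
    rintro _ ⟨r, hr, rfl⟩
    refine ⟨n + 1, ?_⟩
    rw [iterate_smul_of_semilinear hΦ, ← Function.iterate_add_apply, add_comm (n + 1), ← add_assoc,
      hw, ← map_pow, algebraMap_smul, ← TensorProduct.tmul_smul, hn _, TensorProduct.tmul_zero]
    exact Ideal.pow_le_pow_right
      ((Nat.lt_pow_self hp.one_lt).le.trans (Nat.pow_le_pow_right hp.pos n.le_succ))
      (Ideal.pow_mem_pow hr _)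
  obtain ⟨g, x, hx⟩ := exists_frobeniusBaseChange_iterate_eq F hsmul hA w
  rw [← hΦdef] at hx
  refine ⟨x, ?_, fun e r hr ↦ ?_⟩
  · rintro rfl
    rw [TensorProduct.tmul_zero] at hx
    refine hy0 (hFinj g _ (hMinj _ ?_))
    rw [← hone, ← hw, ← Function.iterate_add_apply, add_comm, Function.iterate_add_apply, hx,
      iterate_map_zero]
  · obtain ⟨h, hh⟩ := hN' (e + g) hwmem _ ⟨r, hr, rfl⟩
    rw [Function.iterate_add_apply, hx, hone, algebraMap_smul, ← TensorProduct.tmul_smul,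
      hone] at hh
    exact hFinj _ _ (hMinj _ hh)

end Frobenius

/-- The fibre of `R ⊗ L` over the closed point of a local ring `R` with coefficient field `K` is
Artinian. -/
theorem isArtinianRing_tensorProduct_quotient {K R L : Type*} [Field K] [CommRing R]
    [IsLocalRing R] [Algebra K R] [Field L] [Algebra K L]
    (h : Function.Surjective ((IsLocalRing.residue R).comp (algebraMap K R))) :
    IsArtinianRing ((R ⊗[K] L) ⧸
      (IsLocalRing.maximalIdeal R).map (algebraMap R (R ⊗[K] L))) := by
  let π := Ideal.Quotient.mk ((IsLocalRing.maximalIdeal R).map (algebraMap R (R ⊗[K] L)))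
  let f : L →+* (R ⊗[K] L) ⧸ _ :=
    π.comp (Algebra.TensorProduct.includeRight : L →ₐ[K] R ⊗[K] L).toRingHom
  refine Function.Surjective.isArtinianRing (f := f) fun z ↦ ?_
  obtain ⟨w, rfl⟩ := Ideal.Quotient.mk_surjective z
  induction w with
  | zero => exact ⟨0, by simp⟩
  | tmul r c =>
    obtain ⟨a, ha⟩ := h (IsLocalRing.residue R r)
    refine ⟨a • c, ?_⟩
    change π (1 ⊗ₜ (a • c)) = π (r ⊗ₜ c)
    rw [← TensorProduct.smul_tmul, Ideal.Quotient.eq, ← TensorProduct.sub_tmul]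
    have hmem : a • 1 - r ∈ IsLocalRing.maximalIdeal R := by
      rw [← Algebra.algebraMap_eq_smul_one]
      exact Ideal.Quotient.eq.1 ha
    have : (a • 1 - r) ⊗ₜ[K] c = (1 ⊗ₜ[K] c) * algebraMap R (R ⊗[K] L) (a • 1 - r) := by
      rw [Algebra.TensorProduct.algebraMap_apply, Algebra.TensorProduct.tmul_mul_tmul]
      simp
    rw [this]
    exact Ideal.mul_mem_left _ _ (Ideal.mem_map_of_mem _ hmem)
  | add u v hu hv =>
    obtain ⟨a, ha⟩ := hu
    obtain ⟨b, hb⟩ := hv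
    exact ⟨a + b, by rw [map_add, ha, hb, map_add]⟩

section Main

variable {K R M : Type*} [Field K] [CommRing R] [IsLocalRing R] {p : ℕ} [Fact p.Prime]
  [AddCommGroup M] [Module R M] [IsArtinian R M]

theorem exists_forall_iterate_mem_socle_of_mem_stablePart [IsNoetherianRing R] [CharP R p]
    (ι : K →+* R)
    (hcoeff : Function.Bijective ((IsLocalRing.residue R).comp ι)) (F : M →+ M)
    (hsmul : ∀ (r : R) (m : M), F (r • m) = r ^ p • F m) (hinj : Function.Injective F) {y : M}
    (hy : y ∈ stablePart ι F) (hy0 : y ≠ 0) :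
    ∃ x : M, x ≠ 0 ∧ ∀ e, F^[e] x ∈ Socle R M := by
  have : CharP K p := (RingHom.charP_iff ι ι.injective p).2 inferInstance
  let _ : Algebra K R := ι.toAlgebra
  let L := PerfectClosure K p
  let _ : Algebra K L := (PerfectClosure.of K p).toAlgebra
  have : IsArtinianRing ((R ⊗[K] L) ⧸
      (IsLocalRing.maximalIdeal R).map (algebraMap R (R ⊗[K] L))) :=
    isArtinianRing_tensorProduct_quotient hcoeff.2
  have : CharP (R ⊗[K] L) p :=
    charP_of_injective_algebraMap (FaithfulSMul.algebraMap_injective R (R ⊗[K] L)) p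
  have hL (c : L) : ∃ (g : ℕ) (a : K), c ^ p ^ g = algebraMap K L a := by
    induction c using PerfectClosure.induction_on with
    | _ x =>
      refine ⟨x.1, x.2, ?_⟩
      rw [← iterate_frobenius]
      exact PerfectClosure.iterate_frobenius_mk K p x.1 x.2
  have hroot (c : K) (j : ℕ) : ∃ d : L, d ^ p ^ j = algebraMap K L c := by
    refine ⟨PerfectClosure.mk K p (j, c), ?_⟩
    rw [← iterate_frobenius]
    exact PerfectClosure.iterate_frobenius_mk K p j c
  have hA (a : R ⊗[K] L) : ∃ (g : ℕ) (r : R), a ^ p ^ g = algebraMap R (R ⊗[K] L) r := by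
    induction a with
    | zero => exact ⟨0, 0, by simp⟩
    | tmul r c =>
      obtain ⟨g, a, h⟩ := hL c
      refine ⟨g, a • r ^ p ^ g, ?_⟩
      rw [Algebra.TensorProduct.tmul_pow, h, Algebra.TensorProduct.algebraMap_apply,
        Algebra.algebraMap_self_apply, TensorProduct.smul_tmul, Algebra.algebraMap_eq_smul_one]
    | add u v hu hv =>
      obtain ⟨g, r, hr⟩ := hu
      obtain ⟨h, s, hs⟩ := hv
      refine ⟨g + h, r ^ p ^ h + s ^ p ^ g, ?_⟩
      rw [add_pow_char_pow, pow_add, pow_mul, hr, mul_comm, pow_mul, hs, map_add, map_pow, map_pow]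
  obtain ⟨x, hx0, hx⟩ := exists_forall_smul_iterate_eq_zero hA F hsmul hinj hy0 fun j hj ↦ by
    obtain ⟨n, c, s, hs, rfl⟩ : y ∈ kSpan ι (Set.range F^[j]) := by
      simp only [stablePart, Set.mem_iInter] at hy
      exact hy j hj
    choose t ht using hs
    choose d hd using fun i ↦ hroot (c i) j
    refine ⟨∑ i, ((1 : R) ⊗ₜ[K] d i) ⊗ₜ[R] t i, ?_⟩
    refine (map_sum (AddMonoidHom.mk' _
      (iterate_map_add (frobeniusBaseChange (R ⊗[K] L) F hsmul) j)) _ _).trans ?_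
    rw [TensorProduct.tmul_sum]
    refine Finset.sum_congr rfl fun i _ ↦ ?_
    rw [AddMonoidHom.mk'_apply, frobeniusBaseChange_iterate_tmul, Algebra.TensorProduct.tmul_pow,
      hd, one_pow, ht, ← TensorProduct.smul_tmul, Algebra.algebraMap_eq_smul_one,
      ← TensorProduct.smul_tmul, ← Algebra.algebraMap_eq_smul_one,
      ← Algebra.algebraMap_eq_smul_one, Algebra.TensorProduct.algebraMap_apply]
    rfl
  exact ⟨x, hx0, fun e r hr ↦ hx e r hr⟩

theorem exists_mem_stablePart_of_forall_iterate_mem_socle (ι : K →+* R)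
    (hcoeff : Function.Surjective ((IsLocalRing.residue R).comp ι)) (F : M →+ M)
    (hinj : Function.Injective F) {x : M} (hx0 : x ≠ 0) (hx : ∀ e, F^[e] x ∈ Socle R M) :
    ∃ m ∈ stablePart ι F, m ≠ 0 := by
  let U (j : ℕ) : Submodule R M := Submodule.span R {m | ∃ i, j ≤ i ∧ F^[i] x = m}
  have hU : Antitone U := fun a b h ↦ Submodule.span_mono fun m ⟨i, hi, hm⟩ ↦ ⟨i, h.trans hi, hm⟩
  obtain ⟨N, hN⟩ := IsArtinian.monotone_stabilizes
    (⟨fun e ↦ OrderDual.toDual (U e), hU⟩ : ℕ →o (Submodule R _)ᵒᵈ)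
  have hN' (e : ℕ) : U N ≤ U e :=
    (le_total e N).elim (fun h ↦ hU h) fun h ↦ le_of_eq (hN e h)
  refine ⟨F^[N] x, ?_, fun h ↦ hx0 (hinj.iterate N (h.trans (iterate_map_zero F N).symm))⟩
  simp only [stablePart, Set.mem_iInter]
  intro j _
  have hmem : F^[N] x ∈ U j := hN' j (Submodule.subset_span ⟨N, le_rfl, rfl⟩)
  obtain ⟨n, f, g, hfg⟩ := Submodule.mem_span_set'.1 hmem
  choose c hc using fun i ↦ hcoeff (IsLocalRing.residue R (f i))
  refine ⟨n, c, fun i ↦ g i, fun i ↦ ?_, ?_⟩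
  · obtain ⟨k, hk, h⟩ := (g i).2
    exact ⟨F^[k - j] x, by rw [← Function.iterate_add_apply, Nat.add_sub_cancel' hk, h]⟩
  · rw [← hfg]
    refine Finset.sum_congr rfl fun i _ ↦ ?_
    obtain ⟨k, -, h⟩ := (g i).2
    rw [← sub_eq_zero, ← sub_smul, ← h]
    exact hx k _ (Ideal.Quotient.eq.1 (hc i).symm)

theorem exists_forall_iterate_mem_socle (F : M →+ M)
    (hsmul : ∀ (r : R) (m : M), F (r • m) = r ^ p • F m) (hinj : Function.Injective F)
    (h : ∀ N : ℕ, ∃ e ≥ N, ∃ x : M, x ≠ 0 ∧ F^[e] x ∈ Socle R M) :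
    ∃ x : M, x ≠ 0 ∧ ∀ e, F^[e] x ∈ Socle R M := by
  let S (e : ℕ) : Submodule R M :=
    { carrier := {x | F^[e] x ∈ Socle R M}
      zero_mem' := fun r _ ↦ by rw [iterate_map_zero, smul_zero]
      add_mem' := fun hx hy r hr ↦ by rw [iterate_map_add, smul_add, hx r hr, hy r hr, add_zero]
      smul_mem' := fun a x hx r hr ↦ by
        rw [iterate_smul_of_semilinear hsmul, smul_comm, hx r hr, smul_zero] }
  have hS : Antitone S := antitone_nat_of_succ_le fun e x hx r hr ↦ by
    refine hinj ?_
    rw [hsmul, ← Function.iterate_succ_apply' (f := F), map_zero,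
      ← Nat.sub_add_cancel (Fact.out : p.Prime).one_le, pow_succ, mul_smul, hx r hr, smul_zero]
  obtain ⟨N, hN⟩ := IsArtinian.monotone_stabilizes
    (⟨fun e ↦ OrderDual.toDual (S e), hS⟩ : ℕ →o (Submodule R _)ᵒᵈ)
  obtain ⟨e, he, x, hx0, hx⟩ := h N
  refine ⟨x, hx0, fun d ↦ ?_⟩
  have hxN : x ∈ S N := hS he hx
  exact (le_total d N).elim (fun h ↦ hS h hxN) fun h ↦ (le_of_eq (hN d h) : S N ≤ S d) hxN

end Main

/-- **Main theorem.** Let `(R, 𝔪, k)` be a Noetherian local ring of prime characteristic `p`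
containing a coefficient field `k` (given by `ι : k →+* R` inducing an isomorphism onto the
residue field), and let `M` be an Artinian `R`-module with an injective Frobenius action `F`.
Then `M` is `F`-stable if and only if its stable part `M_s` is nonzero. -/
theorem fStable_iff_stablePart_ne_zero
    {K R M : Type*} [Field K] [CommRing R] [IsLocalRing R] [IsNoetherianRing R]
    (p : ℕ) [Fact p.Prime] [CharP R p]
    (ι : K →+* R) (hcoeff : Function.Bijective ((IsLocalRing.residue R).comp ι))
    [AddCommGroup M] [Module R M] [IsArtinian R M]
    (F : M → M)
    (hadd : ∀ x y : M, F (x + y) = F x + F y)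
    (hsmul : ∀ (r : R) (m : M), F (r • m) = r ^ p • F m)
    (hinj : Function.Injective F) :
    (¬ ∃ N : ℕ, 0 < N ∧ ∀ e ≥ N, Socle R M ∩ (F^[e] '' Socle R M) = {0}) ↔
      ∃ m ∈ stablePart ι F, m ≠ 0 := by
  let F' : M →+ M := AddMonoidHom.mk' F hadd
  have hzero (e : ℕ) : F^[e] 0 = 0 := iterate_map_zero F' e
  have h0 : (0 : M) ∈ Socle R M := fun r _ ↦ smul_zero r
  constructor
  · intro h
    obtain ⟨x, hx0, hx⟩ := exists_forall_iterate_mem_socle F' hsmul hinj fun N ↦ by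
      by_contra! hN
      refine h ⟨N + 1, N.succ_pos, fun e he ↦ ?_⟩
      refine Set.eq_singleton_iff_unique_mem.2 ⟨⟨h0, 0, h0, hzero e⟩, ?_⟩
      rintro _ ⟨hs, x, -, rfl⟩
      by_contra hne
      exact hN e (by lia) x (fun hx ↦ hne (by rw [hx, hzero])) hs
    exact exists_mem_stablePart_of_forall_iterate_mem_socle ι hcoeff.2 F' hinj hx0 hx
  · rintro ⟨y, hy, hy0⟩ ⟨N, -, hN⟩
    obtain ⟨x, hx0, hx⟩ :=
      exists_forall_iterate_mem_socle_of_mem_stablePart ι hcoeff F' hsmul hinj hy hy0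
    have hmem : F^[N] x ∈ Socle R M ∩ (F^[N] '' Socle R M) := ⟨hx N, x, hx 0, rfl⟩
    rw [hN N le_rfl, Set.mem_singleton_iff] at hmem
    exact hx0 (hinj.iterate N (hmem.trans (hzero N).symm))
end

section
/- Let (R, 𝔪, k) be a Noetherian local ring of prime characteristic p containing a coefficient field k, and let M be an Artinian R-module with a Frobenius action F. Then: (1) the stable part M_s is a finite-dimensional k-vector space; (2) F maps M_s into M_s and the restriction F : M_s → M_s is injective; (3) the k-vector subspace of M spanned by F(M_s) coincides with M_s. -/
open Submodule in
/-- A module on which `a` acts locally nilpotently is Artinian as soon as the submodule of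
elements killed by `a` is Artinian. -/
theorem isArtinian_of_torsionBy {A M : Type*} [CommRing A] [AddCommGroup M] [Module A M] (a : A)
    (hnil : ∀ x : M, ∃ n : ℕ, a ^ n • x = 0) [IsArtinian A (torsionBy A M a)] :
    IsArtinian A M := by
  rw [← monotone_stabilizes_iff_artinian]
  intro f
  obtain ⟨L, hfL⟩ : ∃ L : ℕ → Submodule A M, ∀ i, f i = OrderDual.toDual (L i) :=
    ⟨fun i => OrderDual.ofDual (f i), fun _ => rfl⟩
  simp_rw [hfL]
  have hL : ∀ {i j : ℕ}, i ≤ j → L j ≤ L i := fun {i j} h => by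
    have := f.monotone h
    rwa [hfL, hfL, OrderDual.toDual_le_toDual] at this
  let B : ℕ → ℕ → Submodule A (torsionBy A M a) := fun i j =>
    ((L i).map (LinearMap.lsmul A M (a ^ j))).comap (torsionBy A M a).subtype
  have mem_B : ∀ i j (x : torsionBy A M a), x ∈ B i j ↔ ∃ y ∈ L i,
      a ^ j • y = x := fun i j x => by simp [B]
  have hB : ∀ {i i' j j' : ℕ}, i ≤ i' → j ≤ j' → B i' j' ≤ B i j := by
    intro i i' j j' hi hj x hx
    obtain ⟨y, hy, hyx⟩ := (mem_B _ _ _).1 hx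
    refine (mem_B _ _ _).2 ⟨a ^ (j' - j) • y, smul_mem _ _ (hL hi hy), ?_⟩
    rw [smul_smul, ← pow_add, Nat.add_sub_cancel' hj, hyx]
  obtain ⟨n₀, hn₀⟩ := IsArtinian.monotone_stabilizes
    (⟨fun i => OrderDual.toDual (B i i), fun i j h => hB h h⟩ : ℕ →o (Submodule A _)ᵒᵈ)
  replace hn₀ : ∀ m, n₀ ≤ m → B n₀ n₀ = B m m := hn₀
  have hrow : ∀ j, ∃ n, ∀ m, n ≤ m → B n j = B m j := fun j =>
    IsArtinian.monotone_stabilizes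
      (⟨fun i => OrderDual.toDual (B i j), fun _ _ h => hB h le_rfl⟩ : ℕ →o (Submodule A _)ᵒᵈ)
  choose r hr using hrow
  let N := max n₀ ((Finset.range n₀).sup r)
  have hN : ∀ m, N ≤ m → ∀ j, B N j ≤ B m j := by
    intro m hm j
    rcases lt_or_ge j n₀ with hj | hj
    · have h1 : r j ≤ N := le_max_of_le_right (Finset.le_sup (f := r) (Finset.mem_range.2 hj))
      rw [← hr j m (h1.trans hm), ← hr j N h1]
    · calc B N j ≤ B n₀ n₀ := hB (le_max_left _ _) hj
        _ = B (max m j) (max m j) := hn₀ _ (le_max_of_le_right hj)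
        _ ≤ B m j := hB (le_max_left _ _) (le_max_right _ _)
  refine ⟨N, fun m hm => congrArg OrderDual.toDual (le_antisymm ?_ (hL hm))⟩
  suffices h : ∀ t : ℕ, ∀ y ∈ L N, a ^ t • y = 0 → y ∈ L m by
    intro y hy
    obtain ⟨t, ht⟩ := hnil y
    exact h t y hy ht
  intro t
  induction t with
  | zero =>
    intro y _ h
    rw [pow_zero, one_smul] at h
    exact h ▸ zero_mem _
  | succ t ih =>
    intro y hy h
    have hmem : a ^ t • y ∈ torsionBy A M a := by
      rw [mem_torsionBy_iff, smul_smul, ← pow_succ', h]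
    obtain ⟨z, hz, hzy⟩ := (mem_B _ _ _).1 (hN m hm t ((mem_B N t ⟨_, hmem⟩).2 ⟨y, hy, rfl⟩))
    have := ih (y - z) (sub_mem hy (hL hm hz)) (by rw [smul_sub, hzy, sub_self])
    simpa using add_mem this hz

open Submodule in
/-- A module on which finitely many elements `a i` act locally nilpotently is Artinian as soon as
the submodule of elements killed by all the `a i` is Artinian. -/
theorem isArtinian_of_iInf_torsionBy {A M ι : Type*} [CommRing A] [AddCommGroup M] [Module A M]
    [Finite ι] (a : ι → A) (hnil : ∀ i (x : M), ∃ n : ℕ, a i ^ n • x = 0)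
    (h : IsArtinian A (⨅ i, torsionBy A M (a i) : Submodule A M)) :
    IsArtinian A M := by
  classical
  cases nonempty_fintype ι
  suffices H : ∀ s : Finset ι, IsArtinian A (⨅ i ∈ s, torsionBy A M (a i) : Submodule A M) →
      IsArtinian A M from
    H Finset.univ (by rwa [iInf_congr fun i => iInf_pos (Finset.mem_univ i)])
  intro s
  induction s using Finset.induction_on with
  | empty =>
    intro h
    rw [← LinearEquiv.isArtinian_iff (topEquiv (R := A) (M := M))]
    have h0 : (⨅ i ∈ (∅ : Finset ι), torsionBy A M (a i) : Submodule A M) = ⊤ := by simp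
    rwa [h0] at h
  | insert i s _ ih =>
    intro h
    refine ih ?_
    set N : Submodule A M := ⨅ i ∈ s, torsionBy A M (a i)
    rw [Finset.iInf_insert] at h
    have : IsArtinian A (torsionBy A N (a i)) := by
      let f : torsionBy A N (a i) →ₗ[A] (torsionBy A M (a i) ⊓ N : Submodule A M) :=
        (N.subtype.comp (torsionBy A N (a i)).subtype).codRestrict _ fun x =>
          ⟨congrArg Subtype.val x.2, x.1.2⟩
      exact isArtinian_of_injective f fun x y hxy =>
        Subtype.ext (Subtype.ext (congrArg (torsionBy A M (a i) ⊓ N).subtype hxy))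
    refine isArtinian_of_torsionBy (a i) fun x => ?_
    obtain ⟨n, hn⟩ := hnil i x
    exact ⟨n, Subtype.ext hn⟩

open Submodule in
theorem isNoetherian_inf_torsionBy_pow {k A M : Type*} [CommRing k] [CommRing A] [Algebra k A]
    [AddCommGroup M] [Module A M] [Module k M] [IsScalarTower k A M] (N : Submodule A M) (a : A)
    [IsNoetherian k (N ⊓ torsionBy A M a : Submodule A M)] (t : ℕ) :
    IsNoetherian k (N ⊓ torsionBy A M (a ^ t) : Submodule A M) := by
  induction t with
  | zero =>
    have : (N ⊓ torsionBy A M (a ^ 0) : Submodule A M) = ⊥ := by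
      refine eq_bot_iff.2 fun x hx => ?_
      simpa using hx.2
    rw [this]
    infer_instance
  | succ t ih =>
    have hle : (N ⊓ torsionBy A M a : Submodule A M) ≤ N ⊓ torsionBy A M (a ^ (t + 1)) :=
      inf_le_inf_left _ fun x hx => by
        rw [mem_torsionBy_iff] at hx ⊢
        rw [pow_succ, mul_smul, hx, smul_zero]
    let g : (N ⊓ torsionBy A M (a ^ (t + 1)) : Submodule A M) →ₗ[A]
        (N ⊓ torsionBy A M (a ^ t) : Submodule A M) :=
      ((LinearMap.lsmul A M a).comp (Submodule.subtype _)).codRestrict _ fun x =>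
        ⟨smul_mem _ _ x.2.1, by
          have := (mem_torsionBy_iff _ _).1 x.2.2
          refine (mem_torsionBy_iff _ _).2 ?_
          simpa [smul_smul, ← pow_succ] using this⟩
    refine isNoetherian_of_range_eq_ker ((inclusion hle).restrictScalars k)
      (g.restrictScalars k) ?_
    ext x
    constructor
    · rintro ⟨y, rfl⟩
      exact Subtype.ext y.2.2
    · intro hx
      exact ⟨⟨x, x.2.1, congrArg Subtype.val hx⟩, rfl⟩

open Submodule in
/-- If the joint kernel of finitely many elements `a i` is Noetherian, then so is the joint kernel
of their powers. -/
theorem isNoetherian_iInf_torsionBy_pow {k A M ι : Type*} [CommRing k] [CommRing A] [Algebra k A]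
    [AddCommGroup M] [Module A M] [Module k M] [IsScalarTower k A M] [Finite ι] (a : ι → A)
    (h : IsNoetherian k (⨅ i, torsionBy A M (a i) : Submodule A M)) (t : ℕ) :
    IsNoetherian k (⨅ i, torsionBy A M (a i ^ t) : Submodule A M) := by
  classical
  cases nonempty_fintype ι
  suffices H : ∀ s : Finset ι, IsNoetherian k ((⨅ i ∈ sᶜ, torsionBy A M (a i)) ⊓
      ⨅ i ∈ s, torsionBy A M (a i ^ t) : Submodule A M) by
    have h1 := H Finset.univ
    rwa [Finset.compl_univ, show (⨅ i ∈ (∅ : Finset ι), torsionBy A M (a i) : Submodule A M) = ⊤ by simp, top_inf_eq,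
      iInf_congr fun i => iInf_pos (Finset.mem_univ i)] at h1
  intro s
  induction s using Finset.induction_on with
  | empty =>
    have h1 : ((⨅ i ∈ (∅ᶜ : Finset ι), torsionBy A M (a i)) ⊓
        ⨅ i ∈ (∅ : Finset ι), torsionBy A M (a i ^ t) : Submodule A M) =
        ⨅ i, torsionBy A M (a i) := by simp
    rwa [h1]
  | insert i s hi ih =>
    have h1 : (sᶜ : Finset ι) = insert i (insert i s)ᶜ := by
      ext j; by_cases hj : j = i <;> simp [hj, hi]
    rw [h1, Finset.iInf_insert, inf_assoc, inf_comm] at ih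
    rw [Finset.iInf_insert, inf_left_comm, inf_comm]
    exact isNoetherian_inf_torsionBy_pow _ _ t

theorem RingHom.Finite.exists_sum_eq {A B : Type*} [CommRing A] [CommRing B] {f : A →+* B}
    (hf : f.Finite) : ∃ (m : ℕ) (b : Fin m → B), ∀ r : B, ∃ c : Fin m → A,
      r = ∑ i, f (c i) * b i := by
  let := f.toAlgebra
  have : Module.Finite A B := hf
  obtain ⟨m, b, hb⟩ := Module.Finite.exists_fin (R := A) (M := B)
  refine ⟨m, b, fun r => ?_⟩
  obtain ⟨c, hc⟩ := (Submodule.mem_span_range_iff_exists_fun A).1 (hb ▸ Submodule.mem_top (x := r))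
  exact ⟨c, hc.symm.trans (Finset.sum_congr rfl fun i _ => Algebra.smul_def _ _)⟩

section FrobeniusAction

variable {A M : Type*} [CommRing A] [AddCommGroup M] [Module A M] {p : ℕ}

theorem iterate_frobeniusAction_smul (F : M →+ M)
    (hF : ∀ (r : A) (m : M), F (r • m) = r ^ p • F m) (j : ℕ) (r : A) (m : M) :
    F^[j] (r • m) = r ^ p ^ j • F^[j] m := by
  induction j with
  | zero => simp
  | succ j ih => rw [Function.iterate_succ_apply', ih, hF, Function.iterate_succ_apply', ← pow_mul,
      ← pow_succ]

open Submodule in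
/-- If the Frobenius of `A` is finite and `M` is Artinian, then the property that `L` is generated
by elements `F x` with `x ∈ L` passes to the submodule of elements of `L` killed by a suitable
power of `a`. -/
theorem exists_inf_torsionBy_pow_le_span_image (F : M →+ M)
    (hF : ∀ (r : A) (m : M), F (r • m) = r ^ p • F m)
    [ExpChar A p] (hp : 2 ≤ p)
    (hfin : (frobenius A p).Finite) [IsArtinian A M] (L : Submodule A M)
    (hL : L ≤ span A (F '' L)) (a : A) :
    ∃ t : ℕ, 0 < t ∧ L ⊓ torsionBy A M (a ^ t) ≤
      span A (F '' (L ⊓ torsionBy A M (a ^ t) : Submodule A M)) := by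
  obtain ⟨m, b, hb⟩ := hfin.exists_sum_eq
  let f : (Fin m → M) →+ M :=
    { toFun := fun w => ∑ i, b i • F (w i)
      map_zero' := by simp
      map_add' := fun v w => by simp [Finset.sum_add_distrib] }
  have f_apply : ∀ w, f w = ∑ i, b i • F (w i) := fun _ => rfl
  have f_smul : ∀ (r : A) (w : Fin m → M), f (r • w) = r ^ p • f w := fun r w => by
    simp only [f_apply, Pi.smul_apply, hF, Finset.smul_sum, smul_smul, mul_comm]
  have mem_span : ∀ y ∈ span A (F '' (L : Set M)), ∃ w : Fin m → M, (∀ i, w i ∈ L) ∧ f w = y := by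
    intro y hy
    induction hy using span_induction with
    | mem y hy =>
      obtain ⟨x, hx, rfl⟩ := hy
      obtain ⟨c, hc⟩ := hb 1
      refine ⟨fun i => c i • x, fun i => smul_mem _ _ hx, ?_⟩
      simp only [f_apply, hF, smul_smul, ← Finset.sum_smul]
      conv_rhs => rw [← one_smul A (F x), hc]
      simp [frobenius_def, mul_comm]
    | zero => exact ⟨0, fun _ => zero_mem _, map_zero f⟩
    | add x y _ _ hx hy =>
      obtain ⟨v, hv, rfl⟩ := hx
      obtain ⟨w, hw, rfl⟩ := hy
      exact ⟨v + w, fun i => add_mem (hv i) (hw i), map_add f v w⟩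
    | smul r x _ hx =>
      obtain ⟨v, hv, rfl⟩ := hx
      choose c hc using fun i => hb (r * b i)
      refine ⟨fun j => ∑ i, c i j • v i, fun j => sum_mem fun i _ => smul_mem _ _ (hv i), ?_⟩
      simp only [f_apply, map_sum, hF, Finset.smul_sum, smul_smul]
      rw [Finset.sum_comm]
      refine Finset.sum_congr rfl fun i _ => ?_
      rw [← Finset.sum_smul, hc i]
      simp [frobenius_def, mul_comm]
  let K : Submodule A (Fin m → M) :=
    { carrier := {w | (∀ i, w i ∈ L) ∧ f w = 0}
      add_mem' := fun hv hw => ⟨fun i => add_mem (hv.1 i) (hw.1 i), by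
        rw [map_add, hv.2, hw.2, add_zero]⟩
      zero_mem' := ⟨fun _ => zero_mem _, map_zero f⟩
      smul_mem' := fun r w hw => ⟨fun i => smul_mem _ _ (hw.1 i), by
        rw [f_smul, hw.2, smul_zero]⟩ }
  obtain ⟨c, hc⟩ := IsArtinian.monotone_stabilizes
    (⟨fun i => OrderDual.toDual (K.map (LinearMap.lsmul A _ (a ^ i))), fun i j h => by
      refine OrderDual.toDual_le_toDual.2 ?_
      rintro _ ⟨w, hw, rfl⟩
      refine ⟨a ^ (j - i) • w, smul_mem _ _ hw, ?_⟩
      simp [smul_smul, ← pow_add, Nat.sub_add_cancel h]⟩ : ℕ →o (Submodule A (Fin m → M))ᵒᵈ)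
  replace hc : ∀ n, c ≤ n → K.map (LinearMap.lsmul A _ (a ^ c)) =
    K.map (LinearMap.lsmul A _ (a ^ n)) := hc
  refine ⟨p * (c + 1), by positivity, ?_⟩
  rintro y ⟨hy, hay⟩
  replace hay : a ^ (p * (c + 1)) • y = 0 := hay
  obtain ⟨w, hw, rfl⟩ := mem_span y (hL hy)
  have hK : a ^ (c + 1) • w ∈ K := ⟨fun i => smul_mem _ _ (hw i), by
    rw [f_smul, ← pow_mul, mul_comm, hay]⟩
  have hmem := mem_map_of_mem (f := LinearMap.lsmul A _ (a ^ c)) hK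
  rw [hc (c + (c + 1)) (Nat.le_add_right _ _)] at hmem
  obtain ⟨w', hw', h⟩ := hmem
  replace h : a ^ (c + (c + 1)) • w' = a ^ (c + (c + 1)) • w := by
    simpa [smul_smul, ← pow_add, add_comm, add_left_comm] using h
  have hf : f w = f (w - w') := by rw [map_sub, hw'.2, sub_zero]
  rw [hf, f_apply]
  refine sum_mem fun i _ => smul_mem _ _ (subset_span ⟨_, ⟨sub_mem (hw i) (hw'.1 i), ?_⟩, rfl⟩)
  have h1 : a ^ (c + (c + 1)) • (w - w') i = 0 := by
    rw [← Pi.smul_apply, smul_sub, h, sub_self, Pi.zero_apply]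
  have h2 : c + (c + 1) ≤ p * (c + 1) := by nlinarith
  change a ^ (p * (c + 1)) • (w - w') i = 0
  rw [← Nat.sub_add_cancel h2, pow_add, mul_smul, h1, smul_zero]

open Submodule in
theorem span_image_iterate_le (F : M →+ M)
    (hF : ∀ (r : A) (m : M), F (r • m) = r ^ p • F m)
    (L : Submodule A M) (hL : L ≤ span A (F '' L)) (j : ℕ) :
    L ≤ span A (F^[j] '' L) := by
  induction j with
  | zero => simp
  | succ j ih =>
    refine hL.trans (span_le.2 ?_)
    rintro _ ⟨x, hx, rfl⟩
    have := ih hx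
    clear hx
    induction this using span_induction with
    | mem x hx =>
      obtain ⟨y, hy, rfl⟩ := hx
      exact subset_span ⟨y, hy, Function.iterate_succ_apply' _ _ _⟩
    | zero => simp
    | add x y _ _ hx hy => rw [map_add]; exact add_mem hx hy
    | smul r x _ hx => rw [hF]; exact smul_mem _ _ hx

open Submodule in
/-- If `F` is locally nilpotent, and the joint kernels of powers of the `a i` are Noetherian, then
no nonzero submodule `L` is generated by elements `F x` with `x ∈ L`. -/
theorem eq_bot_of_le_span_image (F : M →+ M)
    (hF : ∀ (r : A) (m : M), F (r • m) = r ^ p • F m)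
    [ExpChar A p] (hp : 2 ≤ p) (hfin : (frobenius A p).Finite)
    [IsArtinian A M] {ι : Type*} [Finite ι] (a : ι → A)
    (hnil : ∀ i (x : M), ∃ n : ℕ, a i ^ n • x = 0)
    (hnoeth : ∀ t : ℕ, IsNoetherian A (⨅ i, torsionBy A M (a i ^ t) : Submodule A M))
    (L : Submodule A M) (hL : L ≤ span A (F '' L)) (hLF : ∀ x ∈ L, ∃ j, F^[j] x = 0) :
    L = ⊥ := by
  classical
  cases nonempty_fintype ι
  have key : ∀ s : Finset ι, ∃ N ≤ L, N ≤ span A (F '' N) ∧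
      (∀ i ∈ s, ∃ t : ℕ, N ≤ torsionBy A M (a i ^ t)) ∧
      (N = ⊥ → L = ⊥) := by
    intro s
    induction s using Finset.induction_on with
    | empty => exact ⟨L, le_rfl, hL, by simp, id⟩
    | insert i s _ ih =>
      obtain ⟨N, hNL, hN, hs, hbot⟩ := ih
      obtain ⟨t, ht0, ht⟩ := exists_inf_torsionBy_pow_le_span_image F hF hp hfin N hN (a i)
      refine ⟨_, inf_le_left.trans hNL, ht, fun j hj => ?_, fun h => hbot ?_⟩
      · rcases Finset.mem_insert.1 hj with rfl | hj
        · exact ⟨t, inf_le_right⟩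
        · obtain ⟨u, hu⟩ := hs j hj
          exact ⟨u, inf_le_left.trans hu⟩
      · refine eq_bot_iff.2 fun x hx => ?_
        obtain ⟨n, hn⟩ := hnil i x
        induction n generalizing x with
        | zero => simpa using hn
        | succ n ih =>
          refine ih x hx ?_
          have hmem : a i ^ n • x ∈ N ⊓ torsionBy A M (a i ^ t) := ⟨smul_mem _ _ hx, by
            change a i ^ t • a i ^ n • x = 0
            rw [smul_smul, ← Nat.sub_add_cancel (show 1 ≤ t from ht0), pow_add, pow_one, mul_assoc,
              ← pow_succ', mul_smul, hn, smul_zero]⟩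
          rwa [h, mem_bot] at hmem
  obtain ⟨N, hNL, hN, hs, hbot⟩ := key Finset.univ
  refine hbot ?_
  choose t ht using fun i => hs i (Finset.mem_univ i)
  have hNT : N ≤ ⨅ i, torsionBy A M (a i ^ Finset.univ.sup t) := le_iInf fun i x hx => by
    change a i ^ Finset.univ.sup t • x = 0
    have h1 : a i ^ t i • x = 0 := ht i hx
    rw [← Nat.sub_add_cancel (Finset.le_sup (f := t) (Finset.mem_univ i)), pow_add, mul_smul, h1,
      smul_zero]
  have := hnoeth (Finset.univ.sup t)
  have := isNoetherian_of_le hNT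
  obtain ⟨S, hS⟩ : N.FG := Module.Finite.iff_fg.1 inferInstance
  choose! j hj using hLF
  have hker : ∀ x ∈ span A (S : Set M), F^[S.sup j] x = 0 := by
    intro x hx
    induction hx using span_induction with
    | mem x hx =>
      rw [← Nat.sub_add_cancel (Finset.le_sup (f := j) hx), Function.iterate_add_apply,
        hj x (hNL (hS ▸ subset_span hx)), iterate_map_zero]
    | zero => exact iterate_map_zero F _
    | add x y _ _ hx hy => rw [iterate_map_add, hx, hy, add_zero]
    | smul r x _ hx => rw [iterate_frobeniusAction_smul F hF, hx, smul_zero]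
  refine eq_bot_iff.2 ((span_image_iterate_le F hF N hN (S.sup j)).trans (span_le.2 ?_))
  rintro _ ⟨x, hx, rfl⟩
  exact hker x (hS.symm ▸ hx)

open Submodule in
/-- The **Hartshorne–Speiser–Lyubeznik theorem** for rings with finite Frobenius: the nilpotent
elements of an Artinian module with a Frobenius action are killed by a fixed power of `F`. -/
theorem exists_iterate_eq_zero_of_isArtinian (F : M →+ M)
    (hF : ∀ (r : A) (m : M), F (r • m) = r ^ p • F m) [ExpChar A p] (hp : 2 ≤ p)
    (hfin : (frobenius A p).Finite)
    [IsArtinian A M] {ι : Type*} [Finite ι] (a : ι → A)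
    (hnil : ∀ i (x : M), ∃ n : ℕ, a i ^ n • x = 0)
    (hnoeth : ∀ t : ℕ, IsNoetherian A (⨅ i, torsionBy A M (a i ^ t) : Submodule A M)) :
    ∃ e : ℕ, ∀ x, (∃ j, F^[j] x = 0) → F^[e] x = 0 := by
  have hmono : ∀ {i j : ℕ} {x : M}, i ≤ j → F^[i] x = 0 → F^[j] x = 0 := fun {i j x} h hx => by
    rw [← Nat.sub_add_cancel h, Function.iterate_add_apply, hx, iterate_map_zero]
  let N : Submodule A M :=
    { carrier := {x | ∃ j, F^[j] x = 0}
      zero_mem' := ⟨0, rfl⟩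
      add_mem' := by
        rintro x y ⟨i, hi⟩ ⟨j, hj⟩
        exact ⟨max i j, by rw [iterate_map_add, hmono (le_max_left i j) hi,
          hmono (le_max_right i j) hj, add_zero]⟩
      smul_mem' := by
        rintro r x ⟨j, hj⟩
        exact ⟨j, by rw [iterate_frobeniusAction_smul F hF, hj, smul_zero]⟩ }
  have hNF : ∀ j, ∀ x ∈ N, F^[j] x ∈ N := by
    rintro j x ⟨i, hi⟩
    exact ⟨i, by rw [← Function.iterate_add_apply, hmono (Nat.le_add_right i j) hi]⟩
  obtain ⟨e, he⟩ := IsArtinian.monotone_stabilizes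
    (⟨fun j => OrderDual.toDual (span A (F^[j] '' N)), fun i j h => by
      refine OrderDual.toDual_le_toDual.2 (span_mono ?_)
      rintro _ ⟨x, hx, rfl⟩
      exact ⟨_, hNF (j - i) x hx, by
        rw [← Function.iterate_add_apply, Nat.add_sub_cancel' h]⟩⟩ : ℕ →o (Submodule A M)ᵒᵈ)
  replace he : ∀ n, e ≤ n → span A (F^[e] '' N) = span A (F^[n] '' N) := he
  have hbot := eq_bot_of_le_span_image F hF hp hfin a hnil hnoeth (span A (F^[e] '' N))
    (by
      conv_lhs => rw [he (e + 1) e.le_succ]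
      refine span_mono ?_
      rintro _ ⟨x, hx, rfl⟩
      exact ⟨F^[e] x, subset_span ⟨x, hx, rfl⟩, (Function.iterate_succ_apply' _ _ _).symm⟩)
    (fun x hx => (span_le.2 (by rintro _ ⟨x, hx, rfl⟩; exact hNF e x hx) :
      span A (F^[e] '' N) ≤ N) hx)
  refine ⟨e, fun x hx => ?_⟩
  have : F^[e] x ∈ span A (F^[e] '' (N : Set M)) := subset_span ⟨x, hx, rfl⟩
  rwa [hbot, mem_bot] at this

end FrobeniusAction

theorem MvPolynomial.finite_frobenius (σ L : Type*) [Finite σ] [Field L] (p : ℕ) [ExpChar L p]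
    [PerfectRing L p] : (frobenius (MvPolynomial σ L) p).Finite := by
  refine RingHom.IsIntegral.to_finite (fun x => ?_) ?_
  · exact ⟨Polynomial.X ^ p - Polynomial.C x,
      Polynomial.monic_X_pow_sub_C x (expChar_pos L p).ne', by simp [frobenius_def]⟩
  · have hC : (frobenius (MvPolynomial σ L) p).comp C = C.comp (frobenius L p) := by
      ext x; simp [frobenius_def]
    refine RingHom.FiniteType.of_comp_finiteType (f := C) ?_
    rw [hC]
    refine RingHom.FiniteType.comp ?_ (RingHom.FiniteType.of_surjective _ (surjective_frobenius L p))
    exact RingHom.finiteType_algebraMap.2 (inferInstanceAs (Algebra.FiniteType L (MvPolynomial σ L)))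

theorem iterate_frobeniusAction_sum_smul {A M ι : Type*} [CommRing A] [AddCommGroup M]
    [Module A M] {p : ℕ} (F : M →+ M) (hF : ∀ (r : A) (m : M), F (r • m) = r ^ p • F m) (j : ℕ)
    (s : Finset ι) (c : ι → A) (x : ι → M) :
    F^[j] (∑ i ∈ s, c i • x i) = ∑ i ∈ s, c i ^ p ^ j • F^[j] (x i) := by
  have h := map_sum ((show AddMonoid.End M from F) ^ j) (fun i => c i • x i) s
  rw [AddMonoid.End.coe_pow] at h
  exact h.trans (Finset.sum_congr rfl fun i _ => iterate_frobeniusAction_smul F hF j _ _)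

theorem frobeniusAction_smul_of_tower {L A M : Type*} [CommRing L] [CommRing A] [Algebra L A]
    [AddCommGroup M] [Module A M] [Module L M] [IsScalarTower L A M] {p : ℕ} (F : M →+ M)
    (hF : ∀ (r : A) (m : M), F (r • m) = r ^ p • F m) (c : L) (m : M) :
    F (c • m) = c ^ p • F m := by
  rw [← algebraMap_smul A c, hF, ← map_pow, algebraMap_smul]

open Submodule in
/-- Stable vectors for a Frobenius action over a perfect field: there is a bound on the size of
linearly independent families of vectors in the image of all `F^j`, and `F` is injective on such
vectors. -/
theorem exists_bound_and_eq_zero_of_mem_range_iterate {L A M ι : Type*} [Field L] [CommRing A]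
    [Algebra L A] [AddCommGroup M] [Module A M] [Module L M] [IsScalarTower L A M] [Finite ι]
    {p : ℕ} [ExpChar A p] (hp : 2 ≤ p) (hfin : (frobenius A p).Finite) (F : M →+ M)
    (hF : ∀ (r : A) (m : M), F (r • m) = r ^ p • F m) (a : ι → A)
    (hnil : ∀ i (x : M), ∃ n : ℕ, a i ^ n • x = 0)
    (hfd : Module.Finite L (⨅ i, torsionBy A M (a i) : Submodule A M)) :
    (∃ d : ℕ, ∀ (m : ℕ) (y : Fin m → M), LinearIndependent L y →
      (∀ l j, y l ∈ Set.range F^[j]) → m ≤ d) ∧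
    (∀ x : M, (∀ j, x ∈ Set.range F^[j]) → F x = 0 → x = 0) := by
  have hart : IsArtinian A (⨅ i, torsionBy A M (a i) : Submodule A M) :=
    isArtinian_of_tower L inferInstance
  have : IsArtinian A M := isArtinian_of_iInf_torsionBy a hnil hart
  have h1 : IsNoetherian L (⨅ i, torsionBy A M (a i) : Submodule A M) := inferInstance
  have hnoeth := isNoetherian_iInf_torsionBy_pow (k := L) a h1
  obtain ⟨e, he⟩ := exists_iterate_eq_zero_of_isArtinian F hF hp hfin a hnil
    fun t => isNoetherian_of_tower L (hnoeth t)
  constructor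
  · let T : Submodule A M := ⨅ i, torsionBy A M (a i ^ p ^ e)
    have := hnoeth (p ^ e)
    refine ⟨Module.finrank L T, fun m y hy hyF => ?_⟩
    cases nonempty_fintype ι
    choose n hn using fun (l : Fin m) i => hnil i (y l)
    let j := Finset.univ.sup fun l => Finset.univ.sup (n l)
    have hj : ∀ l i, a i ^ p ^ j • y l = 0 := fun l i => by
      have h1 : n l i ≤ p ^ j := calc
        n l i ≤ Finset.univ.sup (n l) := Finset.le_sup (f := n l) (Finset.mem_univ i)
        _ ≤ j := Finset.le_sup (f := fun l => Finset.univ.sup (n l)) (Finset.mem_univ l)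
        _ ≤ p ^ j := (Nat.lt_pow_self hp).le
      rw [← Nat.sub_add_cancel h1, pow_add, mul_smul, hn, smul_zero]
    choose z hz using fun l => hyF l (j + e)
    have hzT : ∀ l, F^[e] (z l) ∈ T := fun l => (mem_iInf _).2 fun i => by
      change a i ^ p ^ e • F^[e] (z l) = 0
      rw [← iterate_frobeniusAction_smul F hF]
      refine he _ ⟨j + e, ?_⟩
      rw [iterate_frobeniusAction_smul F hF, hz,
        ← Nat.sub_add_cancel (Nat.pow_le_pow_right (by lia) (Nat.le_add_right j e)), pow_add,
        mul_smul, hj, smul_zero]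
    let w : Fin m → T := fun l => ⟨F^[e] (z l), hzT l⟩
    have hw : LinearIndependent L w := by
      rw [Fintype.linearIndependent_iff] at hy ⊢
      intro c hc i
      replace hc : ∑ i, c i • F^[e] (z i) = 0 := by simpa [w] using congrArg T.subtype hc
      have h1 : ∑ i, c i ^ p ^ j • y i = 0 := by
        have h2 := congrArg (F^[j]) hc
        rw [iterate_map_zero,
          iterate_frobeniusAction_sum_smul F (frobeniusAction_smul_of_tower F hF)] at h2
        simpa only [← Function.iterate_add_apply, hz] using h2
      exact pow_eq_zero_iff (by positivity) |>.1 (hy _ h1 i)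
    simpa using hw.fintype_card_le_finrank
  · intro x hx hFx
    obtain ⟨z, rfl⟩ := hx e
    exact he z ⟨e + 1, by rw [Function.iterate_succ_apply', hFx]⟩

section BaseChange

open TensorProduct

/-- The base change to `B` of a Frobenius action on an `A`-module `M`. -/
noncomputable def frobeniusActionBaseChange {A M : Type*} (B : Type*) [CommRing A] [CommRing B]
    [Algebra A B] [AddCommGroup M] [Module A M] (p : ℕ) [ExpChar B p] (F : M →+ M)
    (hF : ∀ (r : A) (m : M), F (r • m) = r ^ p • F m) : B ⊗[A] M →+ B ⊗[A] M :=
  TensorProduct.liftAddHom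
    (((AddMonoidHom.compHom.flip F).comp
      (LinearMap.toAddMonoidHom'.comp (TensorProduct.mk A B M).toAddMonoidHom)).comp
        (frobenius B p : B →+ B))
    fun r b m => by
      simp [frobenius_def, hF, smul_pow]

theorem frobeniusActionBaseChange_tmul {A B M : Type*} [CommRing A] [CommRing B]
    [Algebra A B] [AddCommGroup M] [Module A M] (p : ℕ) [ExpChar B p] (F : M →+ M)
    (hF : ∀ (r : A) (m : M), F (r • m) = r ^ p • F m) (b : B) (m : M) :
    frobeniusActionBaseChange B p F hF (b ⊗ₜ m) = (b ^ p) ⊗ₜ F m :=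
  rfl

theorem frobeniusActionBaseChange_smul {A B M : Type*} [CommRing A] [CommRing B]
    [Algebra A B] [AddCommGroup M] [Module A M] (p : ℕ) [ExpChar B p] (F : M →+ M)
    (hF : ∀ (r : A) (m : M), F (r • m) = r ^ p • F m) (b : B) (x : B ⊗[A] M) :
    frobeniusActionBaseChange B p F hF (b • x) = b ^ p • frobeniusActionBaseChange B p F hF x := by
  induction x with
  | zero => simp
  | add x y hx hy => simp only [smul_add, map_add, hx, hy]
  | tmul c m => simp [frobeniusActionBaseChange_tmul, TensorProduct.smul_tmul', mul_pow]

theorem iterate_frobeniusActionBaseChange_one_tmul {A B M : Type*} [CommRing A] [CommRing B]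
    [Algebra A B] [AddCommGroup M] [Module A M] (p : ℕ) [ExpChar B p] (F : M →+ M)
    (hF : ∀ (r : A) (m : M), F (r • m) = r ^ p • F m) (j : ℕ) (m : M) :
    (frobeniusActionBaseChange B p F hF)^[j] (1 ⊗ₜ m) = 1 ⊗ₜ F^[j] m := by
  induction j with
  | zero => rfl
  | succ j ih =>
    rw [Function.iterate_succ_apply', ih, frobeniusActionBaseChange_tmul, one_pow,
      Function.iterate_succ_apply']

theorem exists_algebraMap_pow_smul_eq_zero {A B M : Type*} [CommRing A] [CommRing B]
    [Algebra A B] [AddCommGroup M] [Module A M] (a : A) (hnil : ∀ x : M, ∃ n : ℕ, a ^ n • x = 0)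
    (x : B ⊗[A] M) : ∃ n : ℕ, algebraMap A B a ^ n • x = 0 := by
  induction x with
  | zero => exact ⟨0, smul_zero _⟩
  | add x y hx hy =>
    obtain ⟨m, hm⟩ := hx
    obtain ⟨n, hn⟩ := hy
    exact ⟨m + n, by rw [smul_add, pow_add, mul_comm, mul_smul, hm, mul_comm, mul_smul, hn,
      smul_zero, smul_zero, add_zero]⟩
  | tmul b m =>
    obtain ⟨n, hn⟩ := hnil m
    exact ⟨n, by rw [← map_pow, algebraMap_smul, TensorProduct.smul_tmul', TensorProduct.smul_tmul,
      hn, TensorProduct.tmul_zero]⟩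

open Submodule in
theorem finite_iInf_torsionBy_tensorProduct {K L A B M ι : Type*} [Field K] [Field L] [Algebra K L]
    [CommRing A] [Algebra K A] [CommRing B] [Algebra L B] [Algebra A B] [Algebra K B]
    [IsScalarTower K L B] [IsScalarTower K A B] [Algebra.IsPushout K L A B] [AddCommGroup M]
    [Module A M] [Module K M] [IsScalarTower K A M] [Finite ι] (a : ι → A)
    (hfd : Module.Finite K (⨅ i, torsionBy A M (a i) : Submodule A M)) :
    Module.Finite L
      (⨅ i, torsionBy B (B ⊗[A] M) (algebraMap A B (a i)) : Submodule B (B ⊗[A] M)) := by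
  classical
  cases nonempty_fintype ι
  have : Algebra.IsPushout K A L B := .symm inferInstance
  have : Module.Flat A B := .isBaseChange K A L B (Algebra.IsPushout.out (R' := L))
  let g : M →ₗ[A] (ι → M) := LinearMap.pi fun i => LinearMap.lsmul A M (a i)
  have hg : LinearMap.ker g = ⨅ i, torsionBy A M (a i) := by
    simp only [g, LinearMap.ker_pi]
    rfl
  have : Module.Finite K (LinearMap.ker g) := by rw [hg]; exact hfd
  have : Module.Finite L (B ⊗[A] LinearMap.ker g) :=
    .equiv (Algebra.IsPushout.cancelBaseChange K L A B (LinearMap.ker g)).symm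
  have hle : (⨅ i, torsionBy B (B ⊗[A] M) (algebraMap A B (a i)) : Submodule B (B ⊗[A] M)) ≤
      LinearMap.ker (AlgebraTensorModule.lTensor B B g) := by
    intro x hx
    rw [LinearMap.mem_ker]
    apply (TensorProduct.piRight A B B fun _ : ι => M).injective
    rw [map_zero]
    ext i
    have h : (TensorProduct.piRight A B B fun _ : ι => M) (AlgebraTensorModule.lTensor B B g x) i =
        algebraMap A B (a i) • x := by
      clear hx
      induction x with
      | zero => simp
      | add x y hx hy => simp only [map_add, smul_add, Pi.add_apply, hx, hy]
      | tmul b m => simp [g]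
    rw [h]
    exact (mem_iInf _).1 hx i
  rw [Module.Flat.ker_lTensor_eq] at hle
  let f := (AlgebraTensorModule.lTensor B B (LinearMap.ker g).subtype).restrictScalars L
  have hfin := Module.Finite.range f
  have : IsNoetherian L
      (LinearMap.range (AlgebraTensorModule.lTensor B B (LinearMap.ker g).subtype)) :=
    isNoetherian_of_isNoetherianRing_of_finite L (LinearMap.range f)
  exact Module.Finite.of_injective ((inclusion hle).restrictScalars L) (inclusion_injective hle)

open Submodule in
theorem map_mem_range_iterate_of_mem_span {K L M N : Type*} [Field K] [Field L] [Algebra K L]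
    [AddCommGroup M] [Module K M] [AddCommGroup N] [Module L N] {p : ℕ} [ExpChar L p]
    [PerfectRing L p] (F : M →+ M) (G : N →+ N) (hG : ∀ (c : L) (x : N), G (c • x) = c ^ p • G x)
    (φ : M →ₛₗ[algebraMap K L] N) (hφ : ∀ x, φ (F x) = G (φ x)) (j : ℕ) {x : M}
    (hx : x ∈ span K (Set.range F^[j])) : φ x ∈ Set.range G^[j] := by
  induction hx using span_induction with
  | mem x hx =>
    obtain ⟨z, rfl⟩ := hx
    exact ⟨φ z, ((show Function.Semiconj φ F G from hφ).iterate_right j z).symm⟩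
  | zero => exact ⟨0, by rw [iterate_map_zero, map_zero]⟩
  | add x y _ _ hx hy =>
    obtain ⟨u, hu⟩ := hx
    obtain ⟨v, hv⟩ := hy
    exact ⟨u + v, by rw [iterate_map_add, hu, hv, map_add]⟩
  | smul c x _ hx =>
    obtain ⟨u, hu⟩ := hx
    obtain ⟨d, hd⟩ := (bijective_iterateFrobenius L p j).2 (algebraMap K L c)
    rw [iterateFrobenius_def] at hd
    exact ⟨d • u, by rw [iterate_frobeniusAction_smul G hG, hd, hu, map_smulₛₗ]⟩

open Submodule in
/-- Descent of the structure of the stable part along an extension `L` of `K` with `L` perfect. -/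
theorem finite_iInf_span_range_iterate_of_semilinear {K L M N : Type*} [Field K] [Field L]
    [Algebra K L] [AddCommGroup M] [Module K M] [AddCommGroup N] [Module L N] {p : ℕ} [ExpChar L p]
    [PerfectRing L p] (F : M →+ M) (G : N →+ N) (hG : ∀ (c : L) (x : N), G (c • x) = c ^ p • G x)
    (φ : M →ₛₗ[algebraMap K L] N) (hφ : ∀ x, φ (F x) = G (φ x))
    (hli : ∀ (m : ℕ) (y : Fin m → M), LinearIndependent K y → LinearIndependent L (φ ∘ y))
    (hbound : ∃ d : ℕ, ∀ (m : ℕ) (y : Fin m → N), LinearIndependent L y →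
      (∀ l j, y l ∈ Set.range G^[j]) → m ≤ d)
    (hinj : ∀ x : N, (∀ j, x ∈ Set.range G^[j]) → G x = 0 → x = 0) :
    Module.Finite K (⨅ j, span K (Set.range F^[j]) : Submodule K M) ∧
    ∀ (m : ℕ) (y : Fin m → M), LinearIndependent K y →
      (∀ l, y l ∈ (⨅ j, span K (Set.range F^[j]) : Submodule K M)) →
      LinearIndependent K (F ∘ y) := by
  set S : Submodule K M := ⨅ j, span K (Set.range F^[j])
  have hmem : ∀ x ∈ S, ∀ j, φ x ∈ Set.range G^[j] := fun x hx j =>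
    map_mem_range_iterate_of_mem_span F G hG φ hφ j ((mem_iInf _).1 hx j)
  constructor
  · obtain ⟨d, hd⟩ := hbound
    refine Module.rank_lt_aleph0_iff.1 ((rank_le (n := d) fun s hs => ?_).trans_lt
      (Cardinal.natCast_lt_aleph0 (n := d)))
    let v : Fin s.card → M := fun l => ((s.equivFin.symm l : S) : M)
    have hv : LinearIndependent K v :=
      (hs.comp _ s.equivFin.symm.injective).map' S.subtype (ker_subtype S)
    exact hd _ _ (hli _ v hv) fun l => hmem _ (s.equivFin.symm l : S).2
  · intro m y hy hyS
    rw [Fintype.linearIndependent_iff]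
    intro c hc i
    choose e he using fun l => surjective_frobenius L p (algebraMap K L (c l))
    simp only [frobenius_def] at he
    have hx : ∑ l, e l • φ (y l) = 0 := by
      refine hinj _ (fun j => ?_) ?_
      · choose z hz using fun l => hmem (y l) (hyS l) j
        choose f hf using fun l => (bijective_iterateFrobenius L p j).2 (e l)
        simp only [iterateFrobenius_def] at hf
        exact ⟨∑ l, f l • z l, by simp only [iterate_frobeniusAction_sum_smul G hG, hf, hz]⟩
      · have h := congrArg φ hc
        simpa only [map_sum, map_smulₛₗ, Function.comp_apply, hφ, map_zero, hG, he] using h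
    have h := he i
    rw [Fintype.linearIndependent_iff.1 (hli m y hy) e hx i, zero_pow (expChar_pos L p).ne'] at h
    exact (map_eq_zero _).1 h.symm

theorem one_tmul_smul {K L A B M : Type*} [CommRing K] [CommRing L] [Algebra K L]
    [CommRing A] [Algebra K A] [CommRing B] [Algebra L B] [Algebra A B] [Algebra K B]
    [IsScalarTower K L B] [IsScalarTower K A B] [AddCommGroup M] [Module A M] [Module K M]
    [IsScalarTower K A M] (c : K) (x : M) :
    (1 : B) ⊗ₜ[A] (c • x) = algebraMap K L c • (1 : B) ⊗ₜ[A] x := by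
  rw [← algebraMap_smul A c x, ← TensorProduct.smul_tmul, algebraMap_smul,
    TensorProduct.smul_tmul', algebraMap_smul]

theorem LinearIndependent.one_tmul_of_isPushout {K L A B M : Type*} [Field K] [Field L]
    [Algebra K L] [CommRing A] [Algebra K A] [CommRing B] [Algebra L B] [Algebra A B] [Algebra K B]
    [IsScalarTower K L B] [IsScalarTower K A B] [Algebra.IsPushout K L A B] [AddCommGroup M]
    [Module A M] [Module K M] [IsScalarTower K A M] {ι : Type*} {y : ι → M}
    (hy : LinearIndependent K y) : LinearIndependent L fun l => (1 : B) ⊗ₜ[A] y l := by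
  have h := (Module.Flat.linearIndependent_one_tmul (S := L) hy).map'
    (Algebra.IsPushout.cancelBaseChange K L A B M).symm.toLinearMap (LinearEquiv.ker _)
  have hy : (fun l => (1 : B) ⊗ₜ[A] y l) =
      (Algebra.IsPushout.cancelBaseChange K L A B M).symm ∘ fun l => (1 : L) ⊗ₜ[K] y l := by
    ext l; simp
  rw [hy]
  exact h

open Submodule in
theorem finite_iInf_span_range_iterate {K A M ι : Type*} (L B : Type*) [Field K] [Field L]
    [Algebra K L] [CommRing A] [Algebra K A] [CommRing B] [Algebra L B] [Algebra A B] [Algebra K B]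
    [IsScalarTower K L B] [IsScalarTower K A B] [Algebra.IsPushout K L A B] [AddCommGroup M]
    [Module A M] [Module K M] [IsScalarTower K A M] [Finite ι] {p : ℕ} (hp : 2 ≤ p) [ExpChar B p]
    [ExpChar L p] [PerfectRing L p] (hfin : (frobenius B p).Finite) (F : M →+ M)
    (hF : ∀ (r : A) (m : M), F (r • m) = r ^ p • F m) (a : ι → A)
    (hnil : ∀ i (x : M), ∃ n : ℕ, a i ^ n • x = 0)
    (hfd : Module.Finite K (⨅ i, torsionBy A M (a i) : Submodule A M)) :
    Module.Finite K (⨅ j, span K (Set.range F^[j]) : Submodule K M) ∧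
    ∀ (m : ℕ) (y : Fin m → M), LinearIndependent K y →
      (∀ l, y l ∈ (⨅ j, span K (Set.range F^[j]) : Submodule K M)) →
      LinearIndependent K (F ∘ y) := by
  have hG := frobeniusActionBaseChange_smul (B := B) p F hF
  obtain ⟨hbound, hinj⟩ := exists_bound_and_eq_zero_of_mem_range_iterate (L := L) hp hfin
    (frobeniusActionBaseChange B p F hF) hG (fun i => algebraMap A B (a i))
    (fun i => exists_algebraMap_pow_smul_eq_zero (a i) (hnil i))
    (finite_iInf_torsionBy_tensorProduct a hfd)
  let φ : M →ₛₗ[algebraMap K L] B ⊗[A] M :=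
    { toFun x := 1 ⊗ₜ x
      map_add' := TensorProduct.tmul_add 1
      map_smul' := one_tmul_smul }
  exact finite_iInf_span_range_iterate_of_semilinear F (frobeniusActionBaseChange B p F hF)
    (frobeniusAction_smul_of_tower _ hG) φ
    (fun x => (iterate_frobeniusActionBaseChange_one_tmul p F hF 1 x).symm)
    (fun m y hy => hy.one_tmul_of_isPushout) hbound hinj

end BaseChange

open Submodule in
theorem MvPolynomial.finite_iInf_span_range_iterate {K σ M : Type*} [Field K] [AddCommGroup M]
    [Module (MvPolynomial σ K) M] [Module K M] [IsScalarTower K (MvPolynomial σ K) M] [Finite σ]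
    (p : ℕ) [Fact p.Prime] [CharP K p] (F : M →+ M)
    (hF : ∀ (r : MvPolynomial σ K) (m : M), F (r • m) = r ^ p • F m)
    (hnil : ∀ i (x : M), ∃ n : ℕ, (X i : MvPolynomial σ K) ^ n • x = 0)
    (hfd : Module.Finite K
      (⨅ i, torsionBy (MvPolynomial σ K) M (X i) : Submodule (MvPolynomial σ K) M)) :
    Module.Finite K (⨅ j, span K (Set.range F^[j]) : Submodule K M) ∧
    ∀ (m : ℕ) (y : Fin m → M), LinearIndependent K y →
      (∀ l, y l ∈ (⨅ j, span K (Set.range F^[j]) : Submodule K M)) →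
      LinearIndependent K (F ∘ y) := by
  have hp : p.Prime := Fact.out
  have : CharP (AlgebraicClosure K) p :=
    charP_of_injective_algebraMap (algebraMap K (AlgebraicClosure K)).injective p
  have : ExpChar (AlgebraicClosure K) p := .prime hp
  have : PerfectRing (AlgebraicClosure K) p := PerfectField.toPerfectRing p
  have : ExpChar (MvPolynomial σ (AlgebraicClosure K)) p := .prime hp
  let : Algebra (MvPolynomial σ K) (MvPolynomial σ (AlgebraicClosure K)) :=
    MvPolynomial.algebraMvPolynomial
  exact _root_.finite_iInf_span_range_iterate (AlgebraicClosure K)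
    (MvPolynomial σ (AlgebraicClosure K)) hp.two_le
    (MvPolynomial.finite_frobenius σ (AlgebraicClosure K) p) F hF X hnil hfd

theorem exists_pow_smul_eq_zero_of_mem_maximalIdeal {R M : Type*} [CommRing R] [IsLocalRing R]
    [AddCommGroup M] [Module R M] [IsArtinian R M] {a : R} (ha : a ∈ IsLocalRing.maximalIdeal R)
    (x : M) : ∃ n : ℕ, a ^ n • x = 0 := by
  obtain ⟨n, ⟨y, hy⟩, h⟩ := IsArtinian.exists_pow_succ_smul_dvd a
    (⟨x, Submodule.mem_span_singleton_self x⟩ : Submodule.span R {x})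
  obtain ⟨r, rfl⟩ := Submodule.mem_span_singleton.1 hy
  replace h : a ^ (n + 1) • r • x = a ^ n • x := congrArg Subtype.val h
  have hu : IsUnit (1 - r * a) := by
    rcases IsLocalRing.isUnit_or_isUnit_one_sub_self (r * a) with h | h
    · exact absurd h ((IsLocalRing.mem_maximalIdeal _).1 (Ideal.mul_mem_left _ r ha))
    · exact h
  refine ⟨n, hu.smul_eq_zero.1 ?_⟩
  rw [sub_smul, one_smul, sub_eq_zero]
  refine h.symm.trans ?_
  rw [smul_smul, smul_smul]
  congr 1
  ring

open Submodule in
theorem finite_torsionBySet_maximalIdeal {K R M : Type*} [Field K] [CommRing R]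
    [IsLocalRing R] [Algebra K R] [AddCommGroup M] [Module R M] [Module K M]
    [IsScalarTower K R M] [IsArtinian R M]
    (hK : ∀ r : R, ∃ c : K, r - algebraMap K R c ∈ IsLocalRing.maximalIdeal R) :
    Module.Finite K (torsionBySet R M (IsLocalRing.maximalIdeal R)) := by
  let T := torsionBySet R M (IsLocalRing.maximalIdeal R : Set R)
  have hT : ∀ (r : R) (c : K), r - algebraMap K R c ∈ IsLocalRing.maximalIdeal R →
      ∀ x : T, r • x = c • x := fun r c h x => by
    rw [← sub_eq_zero, ← algebraMap_smul R c x, ← sub_smul]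
    exact @torsionBySet_isTorsionBySet R M _ _ _ (IsLocalRing.maximalIdeal R) x ⟨_, h⟩
  let f : Submodule K T → Submodule R T := fun N =>
    { N with
      smul_mem' r x hx := by
        obtain ⟨c, hc⟩ := hK r
        rw [hT r c hc]
        exact N.smul_mem c hx }
  have hf : StrictMono f := fun _ _ h => h
  have : IsArtinian K T := hf.wellFoundedLT
  exact IsSemisimpleModule.finite_tfae.out 0 2 |>.2 this

open Submodule in
theorem IsLocalRing.finite_iInf_span_range_iterate {K R M : Type*} [Field K] [CommRing R]
    [IsLocalRing R] [IsNoetherianRing R] [Algebra K R] [AddCommGroup M] [Module R M] [Module K M]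
    [IsScalarTower K R M] [IsArtinian R M] (p : ℕ) [Fact p.Prime] [CharP K p]
    (hK : ∀ r : R, ∃ c : K, r - algebraMap K R c ∈ IsLocalRing.maximalIdeal R)
    (F : M →+ M) (hF : ∀ (r : R) (m : M), F (r • m) = r ^ p • F m) :
    Module.Finite K (⨅ j, span K (Set.range F^[j]) : Submodule K M) ∧
    ∀ (m : ℕ) (y : Fin m → M), LinearIndependent K y →
      (∀ l, y l ∈ (⨅ j, span K (Set.range F^[j]) : Submodule K M)) →
      LinearIndependent K (F ∘ y) := by
  obtain ⟨s, hs⟩ := IsNoetherian.noetherian (IsLocalRing.maximalIdeal R)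
  let f : MvPolynomial s K →ₐ[K] R := MvPolynomial.aeval fun i => (i : R)
  let : Module (MvPolynomial s K) M := Module.compHom M f.toRingHom
  have hf : ∀ (r : MvPolynomial s K) (m : M), r • m = f r • m := fun _ _ => rfl
  have : IsScalarTower K (MvPolynomial s K) M := .of_algebraMap_smul fun c m => by
    rw [hf, f.commutes, algebraMap_smul]
  have hX : ∀ i : s, f (MvPolynomial.X i) = i := fun i => MvPolynomial.aeval_X _ i
  have hmem : ∀ i : s, (i : R) ∈ IsLocalRing.maximalIdeal R := fun i =>
    hs ▸ Submodule.subset_span i.2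
  have hfd := finite_torsionBySet_maximalIdeal (M := M) hK
  refine MvPolynomial.finite_iInf_span_range_iterate (σ := s) p F
    (fun r m => by rw [hf, hf, hF, map_pow]) (fun i x => ?_) ?_
  · simpa only [hf, map_pow, hX] using exists_pow_smul_eq_zero_of_mem_maximalIdeal (hmem i) x
  · have hle : ∀ x ∈ (⨅ i, torsionBy (MvPolynomial s K) M (MvPolynomial.X i) :
        Submodule (MvPolynomial s K) M),
        x ∈ torsionBySet R M (IsLocalRing.maximalIdeal R : Set R) := fun x hx => by
      rw [← (show Ideal.span (s : Set R) = _ from hs), ← torsionBySet_eq_torsionBySet_span,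
        mem_torsionBySet_iff]
      intro i
      rw [← hX i, ← hf]
      exact (mem_iInf _).1 hx i
    let g : (⨅ i, torsionBy (MvPolynomial s K) M (MvPolynomial.X i) :
        Submodule (MvPolynomial s K) M) →ₗ[K]
        torsionBySet R M (IsLocalRing.maximalIdeal R : Set R) :=
      { toFun x := ⟨x, hle x x.2⟩
        map_add' _ _ := rfl
        map_smul' _ _ := rfl }
    exact Module.Finite.of_injective g fun x y h =>
      Subtype.ext (congrArg (torsionBySet R M (IsLocalRing.maximalIdeal R : Set R)).subtype h)

theorem kSpan_eq_span {K R M : Type*} [Field K] [CommRing R] [AddCommGroup M] [Module R M]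
    [Module K M] (ι : K →+* R) (hι : ∀ (c : K) (m : M), c • m = ι c • m) (S : Set M) :
    kSpan ι S = Submodule.span K S := by
  ext x
  rw [SetLike.mem_coe, Submodule.mem_span_set']
  constructor
  · rintro ⟨n, c, s, hs, rfl⟩
    exact ⟨n, c, fun i => ⟨s i, hs i⟩, by simp only [hι]⟩
  · rintro ⟨n, c, s, rfl⟩
    exact ⟨n, c, fun i => s i, fun i => (s i).2, by simp only [hι]⟩

theorem stablePart_eq_iInf_span {K R M : Type*} [Field K] [CommRing R] [AddCommGroup M]
    [Module R M] [Module K M] (ι : K →+* R) (hι : ∀ (c : K) (m : M), c • m = ι c • m)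
    (F : M → M) :
    stablePart ι F = (⨅ j, Submodule.span K (Set.range F^[j]) : Submodule K M) := by
  ext x
  simp only [stablePart, kSpan_eq_span ι hι, Set.mem_iInter, Set.mem_ofPred_eq, SetLike.mem_coe,
    Submodule.mem_iInf]
  refine ⟨fun h j => ?_, fun h j _ => h j⟩
  rcases j.eq_zero_or_pos with rfl | hj
  · simp
  · exact h j hj

theorem map_mem_iInf_span_range_iterate {K M : Type*} [Field K] [AddCommGroup M] [Module K M]
    {p : ℕ} (F : M →+ M) (hF : ∀ (c : K) (m : M), F (c • m) = c ^ p • F m) {x : M}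
    (hx : x ∈ (⨅ j, Submodule.span K (Set.range F^[j]) : Submodule K M)) :
    F x ∈ (⨅ j, Submodule.span K (Set.range F^[j]) : Submodule K M) := by
  rw [Submodule.mem_iInf] at hx ⊢
  intro j
  specialize hx j
  induction hx using Submodule.span_induction with
  | mem x h =>
    obtain ⟨z, rfl⟩ := h
    exact Submodule.subset_span ⟨F z, (Function.iterate_succ_apply F j z).symm.trans
      (Function.iterate_succ_apply' F j z)⟩
  | zero => rw [map_zero]; exact zero_mem _
  | add x y _ _ h h' => rw [map_add]; exact add_mem h h'
  | smul c x _ h => rw [hF]; exact Submodule.smul_mem _ _ h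

theorem injOn_of_linearIndependent_comp {K M : Type*} [Field K] [AddCommGroup M] [Module K M]
    (F : M →+ M) (S : Submodule K M)
    (hli : ∀ (m : ℕ) (y : Fin m → M), LinearIndependent K y → (∀ l, y l ∈ S) →
      LinearIndependent K (F ∘ y)) : Set.InjOn F S := by
  intro x hx y hy hxy
  by_contra hne
  have h := hli 1 (fun _ => x - y) (LinearIndependent.of_subsingleton 0 (sub_ne_zero.2 hne))
    fun _ => S.sub_mem hx hy
  exact h.ne_zero 0 ((map_sub F x y).trans (sub_eq_zero.2 hxy))

theorem span_image_eq_of_linearIndependent_comp {K M : Type*} [Field K] [AddCommGroup M]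
    [Module K M] (F : M → M) (S : Submodule K M) [Module.Finite K S] (hmaps : ∀ x ∈ S, F x ∈ S)
    (hli : ∀ (m : ℕ) (y : Fin m → M), LinearIndependent K y → (∀ l, y l ∈ S) →
      LinearIndependent K (F ∘ y)) : Submodule.span K (F '' S) = S := by
  have hle : Submodule.span K (F '' S) ≤ S :=
    Submodule.span_le.2 fun _ ⟨x, hx, h⟩ => h ▸ hmaps x hx
  refine Submodule.eq_of_le_of_finrank_le hle ?_
  have : Module.Finite K (Submodule.span K (F '' S)) := Submodule.finiteDimensional_of_le hle
  let e := Module.finBasis K S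
  let w : Fin (Module.finrank K S) → Submodule.span K (F '' S) := fun l =>
    ⟨F (e l), Submodule.subset_span ⟨e l, (e l).2, rfl⟩⟩
  have hw : LinearIndependent K w := .of_comp (Submodule.subtype _)
    (hli _ (fun l => (e l : M)) (e.linearIndependent.map' _ S.ker_subtype) fun l => (e l).2)
  simpa using hw.fintype_card_le_finrank

/-- **Hartshorne–Speiser; Lyubeznik.** Let `(R, 𝔪, k)` be a Noetherian local ring of prime
characteristic `p` containing a coefficient field `k` (given by `ι : k →+* R` inducing an
isomorphism onto the residue field), and let `M` be an Artinian `R`-module with a Frobenius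
action `F`.  Then: (1) the stable part `M_s` is a finite-dimensional `k`-vector space (it is
the `k`-span of finitely many elements); (2) `F` maps `M_s` into itself and is injective on
`M_s`; (3) the `k`-span of `F(M_s)` is `M_s`. -/
theorem stablePart_finiteDimensional_and_frobenius_bijective
    {K R M : Type*} [Field K] [CommRing R] [IsLocalRing R] [IsNoetherianRing R]
    (p : ℕ) [Fact p.Prime] [CharP R p]
    (ι : K →+* R) (hcoeff : Function.Bijective ((IsLocalRing.residue R).comp ι))
    [AddCommGroup M] [Module R M] [IsArtinian R M]
    (F : M → M)
    (hadd : ∀ x y : M, F (x + y) = F x + F y)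
    (hsmul : ∀ (r : R) (m : M), F (r • m) = r ^ p • F m) :
    (∃ (n : ℕ) (b : Fin n → M), stablePart ι F = kSpan ι (Set.range b)) ∧
    (∀ m ∈ stablePart ι F, F m ∈ stablePart ι F) ∧
    Set.InjOn F (stablePart ι F) ∧
    kSpan ι (F '' stablePart ι F) = stablePart ι F := by
  let : Algebra K R := ι.toAlgebra
  let : Module K M := Module.compHom M ι
  have hι : ∀ (c : K) (m : M), c • m = ι c • m := fun _ _ => rfl
  have : IsScalarTower K R M := .of_algebraMap_smul fun _ _ => rfl
  have : CharP K p := (RingHom.charP_iff ι ι.injective p).2 inferInstance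
  have hK : ∀ r : R, ∃ c : K, r - algebraMap K R c ∈ IsLocalRing.maximalIdeal R := fun r => by
    obtain ⟨c, hc⟩ := hcoeff.2 (IsLocalRing.residue R r)
    refine ⟨c, (IsLocalRing.residue_eq_zero_iff _).1 ?_⟩
    rw [map_sub, sub_eq_zero]
    exact hc.symm
  let G : M →+ M := AddMonoidHom.mk' F hadd
  obtain ⟨hfin, hli⟩ := IsLocalRing.finite_iInf_span_range_iterate p hK G hsmul
  have hmaps : ∀ x ∈ (⨅ j, Submodule.span K (Set.range G^[j]) : Submodule K M),
      G x ∈ (⨅ j, Submodule.span K (Set.range G^[j]) : Submodule K M) := fun x hx =>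
    map_mem_iInf_span_range_iterate G (frobeniusAction_smul_of_tower G hsmul) hx
  have hS : stablePart ι F = (⨅ j, Submodule.span K (Set.range G^[j]) : Submodule K M) :=
    stablePart_eq_iInf_span ι hι F
  generalize (⨅ j, Submodule.span K (Set.range G^[j]) : Submodule K M) = S at *
  simp only [kSpan_eq_span ι hι, hS]
  refine ⟨?_, hmaps, injOn_of_linearIndependent_comp G S hli,
    congrArg _ (span_image_eq_of_linearIndependent_comp G S hmaps hli)⟩
  obtain ⟨n, b, hb⟩ := Submodule.fg_iff_exists_fin_generating_family.1 (Module.Finite.iff_fg.1 hfin)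
  exact ⟨n, b, congrArg _ hb.symm⟩
end

section
/- Let (R, 𝔪) be a Cohen–Macaulay Noetherian local ring of prime characteristic p in which every parameter ideal is Frobenius closed (i.e., R is F-injective and Cohen–Macaulay). Then for every parameter ideal I and every x ∈ R, one has I(x) = Ĩ(x); that is, if c ∈ R satisfies c·x^q ∈ I^{[q]} for all sufficiently large q = p^e, then c·x^q ∈ I^{[q]} for all q = p^e. -/
/-- The `q`-th bracket power `I^{[q]}` of an ideal `I` in a ring of characteristic `p`
(for `q = p^e`): the ideal generated by the `q`-th powers of the elements of `I`. -/
def bracketPow {R : Type*} [CommRing R] (I : Ideal R) (q : ℕ) : Ideal R :=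
  Ideal.span ((fun a => a ^ q) '' (I : Set R))

/-- An ideal `I` of a ring of prime characteristic `p` is Frobenius closed if its Frobenius
closure `I^F = {x : x^q ∈ I^{[q]} for some q = p^e}` equals `I`, i.e. whenever
`x^{p^e} ∈ I^{[p^e]}` for some `e`, already `x ∈ I`. -/
def FrobeniusClosed {R : Type*} [CommRing R] (p : ℕ) (I : Ideal R) : Prop :=
  ∀ x : R, (∃ e : ℕ, x ^ p ^ e ∈ bracketPow I (p ^ e)) → x ∈ I

/-- A parameter ideal of a `d`-dimensional Noetherian local ring: an ideal generated by a
system of parameters, i.e. by `d` elements generating an ideal primary to the maximal ideal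
(equivalently, with radical equal to the maximal ideal). -/
def IsParameterIdeal {R : Type*} [CommRing R] [IsLocalRing R] (I : Ideal R) : Prop :=
  ∃ (n : ℕ) (x : Fin n → R), ringKrullDim R = n ∧ I = Ideal.span (Set.range x) ∧
    I.radical = IsLocalRing.maximalIdeal R

/-- A Noetherian local ring is Cohen–Macaulay if and only if some system of parameters is a
regular sequence; we take this characterization as the definition. -/
def IsCohenMacaulayLocal (R : Type*) [CommRing R] [IsLocalRing R] : Prop :=
  ∃ (n : ℕ) (x : Fin n → R), ringKrullDim R = n ∧
    (Ideal.span (Set.range x)).radical = IsLocalRing.maximalIdeal R ∧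
    RingTheory.Sequence.IsRegular R (List.ofFn x)

/-- `Ĩ(x)`: the ideal of all `c ∈ R` such that `c·x^q ∈ I^{[q]}` for every `q = p^e`. -/
def ITilde {R : Type*} [CommRing R] (p : ℕ) (I : Ideal R) (x : R) : Ideal R :=
  ⨅ e : ℕ, Submodule.colon (bracketPow I (p ^ e)) (Ideal.span {x ^ p ^ e})

theorem bracketPow_eq_map_iterateFrobenius {R : Type*} [CommRing R] (p : ℕ) [Fact p.Prime]
    [CharP R p] (I : Ideal R) (e : ℕ) :
    bracketPow I (p ^ e) = I.map (iterateFrobenius R p e) :=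
  rfl

theorem bracketPow_mul_le {R : Type*} [CommRing R] (I : Ideal R) (q r : ℕ) :
    bracketPow I (q * r) ≤ bracketPow (bracketPow I q) r := by
  refine Ideal.span_le.2 ?_
  rintro _ ⟨a, ha, rfl⟩
  exact Ideal.subset_span ⟨a ^ q, Ideal.subset_span ⟨a, ha, rfl⟩, (pow_mul a q r).symm⟩

theorem radical_bracketPow {R : Type*} [CommRing R] (I : Ideal R) {q : ℕ} (hq : q ≠ 0) :
    (bracketPow I q).radical = I.radical := by
  apply le_antisymm
  · refine Ideal.radical_mono (Ideal.span_le.2 ?_)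
    rintro _ ⟨a, ha, rfl⟩
    exact I.pow_mem_of_mem ha q (Nat.pos_of_ne_zero hq)
  · exact Ideal.radical_le_radical_iff.2 fun a ha => ⟨q, Ideal.subset_span ⟨a, ha, rfl⟩⟩

theorem isParameterIdeal_bracketPow {R : Type*} [CommRing R] [IsLocalRing R] (p : ℕ)
    [Fact p.Prime] [CharP R p] {I : Ideal R} (hI : IsParameterIdeal I) (e : ℕ) :
    IsParameterIdeal (bracketPow I (p ^ e)) := by
  obtain ⟨n, y, hn, hy, hrad⟩ := hI
  refine ⟨n, fun i => y i ^ p ^ e, hn, ?_, ?_⟩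
  · rw [bracketPow_eq_map_iterateFrobenius, hy, Ideal.map_span, ← Set.range_comp]
    rfl
  · rw [radical_bracketPow I (pow_ne_zero e (Fact.out : p.Prime).ne_zero), hrad]

/-- Let `(R, 𝔪)` be a Cohen–Macaulay Noetherian local ring of prime characteristic `p` in
which every parameter ideal is Frobenius closed (i.e. `R` is F-injective and Cohen–Macaulay).
Then for every parameter ideal `I` and every `x ∈ R`, `I(x) = Ĩ(x)`: if `c·x^q ∈ I^{[q]}` for
all sufficiently large `q = p^e`, then `c·x^q ∈ I^{[q]}` for all `q = p^e`. -/
theorem Ix_eq_ITildex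
    {R : Type*} [CommRing R] [IsLocalRing R] [IsNoetherianRing R]
    (p : ℕ) [Fact p.Prime] [CharP R p]
    (hCM : IsCohenMacaulayLocal R)
    (hfrob : ∀ J : Ideal R, IsParameterIdeal J → FrobeniusClosed p J)
    (I : Ideal R) (hI : IsParameterIdeal I) (x : R) :
    {c : R | ∃ N : ℕ, ∀ e ≥ N, c * x ^ p ^ e ∈ bracketPow I (p ^ e)} =
      {c : R | ∀ e : ℕ, c * x ^ p ^ e ∈ bracketPow I (p ^ e)} := by
  refine Set.Subset.antisymm ?_ fun c hc => ⟨0, fun e _ => hc e⟩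
  rintro c ⟨N, hN⟩ e
  refine hfrob _ (isParameterIdeal_bracketPow p hI e) _ ⟨N, bracketPow_mul_le I _ _ ?_⟩
  rw [mul_pow, ← pow_mul, ← pow_add,
    ← pow_sub_one_mul (pow_ne_zero N (Fact.out : p.Prime).ne_zero) c, mul_assoc]
  exact Ideal.mul_mem_left _ _ (hN (e + N) (Nat.le_add_left N e))
end

section
/- Let (R, 𝔪) be a Cohen–Macaulay Noetherian local ring of prime characteristic p in which every parameter ideal is Frobenius closed. Then the set B(R) = {P ∈ Spec R : P = I(x) for some parameter ideal I of R and some x ∈ R} is finite. -/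
section FrobeniusAction

variable {R M : Type*} [CommRing R] [AddCommGroup M] [Module R M] {p : ℕ} {F : M →+ M}

lemma iterate_smul_of_frobenius_smul (hF : ∀ (r : R) (h : M), F (r • h) = r ^ p • F h)
    (e : ℕ) (r : R) (h : M) : F^[e] (r • h) = r ^ p ^ e • F^[e] h := by
  induction e with
  | zero => simp
  | succ e ih => rw [Function.iterate_succ_apply', ih, hF, Function.iterate_succ_apply',
      ← pow_mul, pow_succ]

/-- The largest submodule stable under the Frobenius action `F` that is killed by `c`. -/
def stableTorsion (hF : ∀ (r : R) (h : M), F (r • h) = r ^ p • F h) (c : Ideal R) :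
    Submodule R M where
  carrier := {h | ∀ e, ∀ r ∈ c, r • F^[e] h = 0}
  add_mem' := by
    intro a b ha hb e r hr
    rw [iterate_map_add, smul_add, ha e r hr, hb e r hr, add_zero]
  zero_mem' := by
    intro e r _
    rw [iterate_map_zero, smul_zero]
  smul_mem' := by
    intro a h hh e r hr
    rw [iterate_smul_of_frobenius_smul hF, smul_comm, hh e r hr, smul_zero]

/-- A submodule is stable under `F`. -/
def IsStable (F : M →+ M) (N : Submodule R M) : Prop := ∀ h ∈ N, F h ∈ N

/-- The primes that are annihilators of stable submodules. -/
def specialPrimes (R : Type*) {M : Type*} [CommRing R] [AddCommGroup M] [Module R M]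
    (F : M →+ M) : Set (Ideal R) :=
  {P | P.IsPrime ∧ ∃ N : Submodule R M, IsStable F N ∧ N.annihilator = P}

lemma IsStable.iterate {N : Submodule R M} (hN : IsStable F N) (e : ℕ) {h : M} (hh : h ∈ N) :
    F^[e] h ∈ N := by
  induction e with
  | zero => exact hh
  | succ e ih => rw [Function.iterate_succ_apply']; exact hN _ ih

lemma IsStable.sup {N N' : Submodule R M} (hN : IsStable F N) (hN' : IsStable F N') :
    IsStable F (N ⊔ N') := by
  intro h hh
  obtain ⟨a, ha, b, hb, rfl⟩ := Submodule.mem_sup.1 hh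
  rw [map_add]
  exact Submodule.add_mem_sup (hN a ha) (hN' b hb)

lemma IsStable.inf {N N' : Submodule R M} (hN : IsStable F N) (hN' : IsStable F N') :
    IsStable F (N ⊓ N') := fun h hh => ⟨hN h hh.1, hN' h hh.2⟩

lemma IsStable.finset_sup {ι : Type*} (s : Finset ι) {N : ι → Submodule R M}
    (hN : ∀ i ∈ s, IsStable F (N i)) : IsStable F (s.sup N) := by
  refine Finset.sup_induction ?_ (fun a ha b hb => ha.sup hb) hN
  intro h hh
  rw [Submodule.mem_bot] at hh
  simp [hh]

lemma IsStable.ideal_smul (hF : ∀ (r : R) (h : M), F (r • h) = r ^ p • F h) (hp : p ≠ 0)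
    {N : Submodule R M} (hN : IsStable F N) (c : Ideal R) : IsStable F (c • N) := by
  intro h hh
  induction hh using Submodule.smul_induction_on' with
  | smul r hr _ hn =>
    rw [hF]
    exact Submodule.smul_mem_smul (Ideal.pow_mem_of_mem _ hr _ (Nat.pos_of_ne_zero hp)) (hN _ hn)
  | add x _ y _ hx hy => rw [map_add]; exact add_mem hx hy

variable (hF : ∀ (r : R) (h : M), F (r • h) = r ^ p • F h)

lemma isStable_stableTorsion (c : Ideal R) : IsStable F (stableTorsion hF c) := by
  intro h hh e r hr
  rw [← Function.iterate_succ_apply]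
  exact hh _ r hr

lemma smul_eq_zero_of_mem_stableTorsion {c : Ideal R} {h : M} (hh : h ∈ stableTorsion hF c)
    {r : R} (hr : r ∈ c) : r • h = 0 := hh 0 r hr

lemma IsStable.le_stableTorsion {c : Ideal R} {N : Submodule R M} (hN : IsStable F N)
    (h : ∀ n ∈ N, ∀ r ∈ c, r • n = 0) : N ≤ stableTorsion hF c :=
  fun _ hn e r hr => h _ (hN.iterate e hn) r hr

/-- A stable submodule not killed by `c` yields a special prime, containing
the annihilator of its image modulo `stableTorsion hF c`, that does not contain `c`. -/
lemma exists_specialPrime [IsNoetherianRing R] (hp : 2 ≤ p) (hinj : Function.Injective F)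
    (c : Ideal R) {N : Submodule R M} (hN : IsStable F N) (hNc : ¬ N ≤ stableTorsion hF c) :
    ∃ P ∈ specialPrimes R F, ¬ c ≤ P ∧
      ∀ r : R, (∀ n ∈ N, r • n ∈ stableTorsion hF c) → r ∈ P := by
  let Z := stableTorsion hF c
  let A : Submodule R M → Ideal R := fun K => Z.colon (K : Set M)
  have hA : ∀ K r, r ∈ A K ↔ ∀ n ∈ K, r • n ∈ Z := fun K r => Submodule.mem_colon
  let S : Set (Ideal R) := {I | ∃ K : Submodule R M, IsStable F K ∧ K ≤ N ∧ ¬ K ≤ Z ∧ A K = I}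
  obtain ⟨P, ⟨K, hK, hKN, hKZ, rfl⟩, hmax⟩ := set_has_maximal_iff_noetherian.2 ‹_› S
    ⟨_, N, hN, le_rfl, hNc, rfl⟩
  have key : ∀ r, r ∈ A K ↔ ∀ n ∈ K, ∀ a ∈ c, r • a • n = 0 := by
    intro r
    rw [hA]
    refine ⟨fun h n hn a ha => ?_, fun h n hn e a ha => ?_⟩
    · rw [smul_comm]; exact h n hn 0 a ha
    · rw [iterate_smul_of_frobenius_smul hF, smul_comm]
      obtain ⟨k, hk⟩ := Nat.exists_eq_succ_of_ne_zero (pow_ne_zero e (by lia : p ≠ 0))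
      rw [hk, pow_succ, mul_smul, h _ (hK.iterate e hn) a ha, smul_zero]
  have hprime : (A K).IsPrime := by
    refine ⟨fun h => hKZ fun n hn => ?_, fun {a b} hab => ?_⟩
    · simpa using (hA K 1).1 (h ▸ Submodule.mem_top) n hn
    · by_contra! hcon
      obtain ⟨ha, hb⟩ := hcon
      let K' := K.map (LinearMap.lsmul R M b)
      have hmem : ∀ n ∈ K, b • n ∈ K' := fun n hn => Submodule.mem_map_of_mem hn
      have hK'K : K' ≤ K := Submodule.map_le_iff_le_comap.2 fun n hn => K.smul_mem b hn
      have hK' : IsStable F K' := by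
        rintro _ ⟨n, hn, rfl⟩
        obtain ⟨k, rfl⟩ := Nat.exists_eq_add_of_le' hp
        rw [LinearMap.lsmul_apply, hF, show k + 2 = 1 + (k + 1) by lia, pow_add, pow_one, mul_smul]
        exact hmem _ (K.smul_mem _ (hK n hn))
      refine hmax (A K') ⟨K', hK', hK'K.trans hKN, fun hle => hb ?_, rfl⟩ ?_
      · exact (hA K b).2 fun n hn => hle (hmem n hn)
      · refine lt_of_le_of_ne (fun r hr => (hA _ _).2 fun n hn => (hA _ _).1 hr n (hK'K hn)) ?_
        intro heq
        apply ha
        rw [heq, hA]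
        intro n hn
        obtain ⟨m, hm, rfl⟩ := hn
        have := (hA K _).1 hab m hm
        rwa [mul_smul] at this
  refine ⟨A K, ⟨hprime, c • K, hK.ideal_smul hF (by lia) c, ?_⟩, fun hc => hKZ ?_, ?_⟩
  · ext r
    rw [Submodule.mem_annihilator, key]
    refine ⟨fun h n hn a ha => h _ (Submodule.smul_mem_smul ha hn), fun h n hn => ?_⟩
    induction hn using Submodule.smul_induction_on' with
    | smul a ha n hn => exact h n hn a ha
    | add x _ y _ hx hy => rw [smul_add, hx, hy, add_zero]
  · refine hK.le_stableTorsion hF fun n hn r hr => hinj ?_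
    obtain ⟨k, rfl⟩ := Nat.exists_eq_add_of_le' hp
    rw [map_zero, hF, pow_add, pow_two, mul_smul, mul_smul,
      (key r).1 (hc hr) _ (hK n hn) r hr, smul_zero]
  · intro r hr
    exact (hA K r).2 fun n hn => hr n (hKN hn)

lemma mem_of_forall_smul_stableTorsion {P : Ideal R} (hP : P ∈ specialPrimes R F) {r : R}
    (h : ∀ n ∈ stableTorsion hF P, r • n = 0) : r ∈ P := by
  obtain ⟨-, N, hN, rfl⟩ := hP
  rw [Submodule.mem_annihilator]
  intro n hn
  exact h n (hN.le_stableTorsion hF (fun n hn r hr => Submodule.mem_annihilator.1 hr n hn) hn)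

/-- The maximal elements of the complement of a finite upward closed set of special primes
are finite in number. -/
lemma finite_maximal_specialPrimes
    (hF : ∀ (r : R) (h : M), F (r • h) = r ^ p • F h)
    [IsNoetherianRing R] [IsArtinian R M] (hp : 2 ≤ p)
    (hinj : Function.Injective F) {T : Set (Ideal R)} (hT : T.Finite)
    (hup : ∀ P ∈ T, ∀ Q ∈ specialPrimes R F, P ≤ Q → Q ∈ T) :
    {P | Maximal (· ∈ specialPrimes R F \ T) P}.Finite := by
  classical
  set X := {P | Maximal (· ∈ specialPrimes R F \ T) P} with hX
  let c : Ideal R := hT.toFinset.inf id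
  have hc : ∀ P : Ideal R, P.IsPrime → c ≤ P → ∃ Q ∈ T, Q ≤ P := by
    intro P hP hcP
    obtain ⟨Q, hQ, hQP⟩ := (Ideal.IsPrime.inf_le' hP).1 hcP
    exact ⟨Q, by simpa using hQ, hQP⟩
  have hcT : ∀ P ∈ T, c ≤ P := fun P hP => Finset.inf_le (f := id) (by simpa using hP)
  let Z := stableTorsion hF c
  let f : X → Submodule R (M ⧸ Z) := fun Q => (stableTorsion hF Q.1).map Z.mkQ
  have hind : iSupIndep f := by
    rw [iSupIndep_iff_supIndep]
    intro s
    rw [Finset.supIndep_iff_disjoint_erase]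
    intro Q hQ
    rw [Submodule.disjoint_def]
    intro x hx hx'
    have hsup : ((s.erase Q).sup f) = ((s.erase Q).sup fun Q => stableTorsion hF Q.1).map Z.mkQ := by
      rw [Finset.sup_eq_iSup, Finset.sup_eq_iSup]
      simp_rw [Submodule.map_iSup]
      rfl
    rw [hsup] at hx'
    obtain ⟨m, hm, rfl⟩ := hx
    obtain ⟨m', hm', hmm'⟩ := hx'
    let L := (s.erase Q).sup fun Q => stableTorsion hF Q.1
    have hstZ : IsStable F Z := isStable_stableTorsion hF c
    have hstL : IsStable F L := IsStable.finset_sup _ fun i _ => isStable_stableTorsion hF i.1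
    let W := stableTorsion hF Q.1 ⊓ (L ⊔ Z)
    have hW : IsStable F W := (isStable_stableTorsion hF _).inf (hstL.sup hstZ)
    have hmW : m ∈ W := by
      refine ⟨hm, ?_⟩
      have : m - m' ∈ Z := by
        rw [← Submodule.Quotient.eq]; exact hmm'.symm
      rw [show m = m' + (m - m') by abel]
      exact Submodule.add_mem_sup hm' this
    rw [Submodule.mkQ_apply, Submodule.Quotient.mk_eq_zero]
    by_contra hmZ
    obtain ⟨P, hP, hcP, hPW⟩ := exists_specialPrime hF hp hinj c hW fun h => hmZ (h hmW)
    have hPT : P ∈ specialPrimes R F \ T := ⟨hP, fun h => hcP (hcT P h)⟩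
    have hQP : Q.1 ≤ P := fun r hr => hPW r fun n hn => by
      rw [smul_eq_zero_of_mem_stableTorsion hF hn.1 hr]; exact zero_mem _
    have hinf : (s.erase Q).inf (fun Q => Q.1) ≤ P := by
      intro r hr
      refine hPW r fun n hn => ?_
      obtain ⟨l, hl, z, hz, rfl⟩ := Submodule.mem_sup.1 hn.2
      rw [smul_add]
      refine add_mem ?_ (Submodule.smul_mem _ _ hz)
      have : L ≤ LinearMap.ker (LinearMap.lsmul R M r) := by
        refine Finset.sup_le fun i hi n hn => ?_
        rw [LinearMap.mem_ker, LinearMap.lsmul_apply]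
        exact smul_eq_zero_of_mem_stableTorsion hF hn (Finset.inf_le (f := fun Q : X => Q.1) hi hr)
      have h0 : r • l = 0 := this hl
      rw [h0]; exact zero_mem _
    obtain ⟨Q', hQ', hQ'P⟩ := (Ideal.IsPrime.inf_le' hP.1).1 hinf
    have e1 : Q.1 = P := le_antisymm hQP (Q.2.2 hPT hQP)
    have e2 : Q'.1 = P := le_antisymm hQ'P (Q'.2.2 hPT hQ'P)
    exact (Finset.mem_erase.1 hQ').1 (Subtype.ext (e2.trans e1.symm))
  have hne : ∀ Q, f Q ≠ ⊥ := by
    intro Q hQ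
    have hle : stableTorsion hF Q.1 ≤ Z := fun n hn => by
      have hmem : Z.mkQ n ∈ f Q := Submodule.mem_map_of_mem hn
      rwa [hQ, Submodule.mem_bot, Submodule.mkQ_apply, Submodule.Quotient.mk_eq_zero] at hmem
    have hQs : Q.1 ∈ specialPrimes R F \ T := Q.2.1
    have hcQ : c ≤ Q.1 := fun r hr => mem_of_forall_smul_stableTorsion hF hQs.1 fun n hn =>
      smul_eq_zero_of_mem_stableTorsion hF (hle hn) hr
    obtain ⟨P, hP, hPQ⟩ := hc Q.1 hQs.1.1 hcQ
    exact hQs.2 (hup P hP _ hQs.1 hPQ)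
  have := WellFoundedLT.finite_of_iSupIndep hind hne
  exact Set.toFinite X

theorem finite_specialPrimes
    (hF : ∀ (r : R) (h : M), F (r • h) = r ^ p • F h)
    [IsNoetherianRing R] [IsLocalRing R] [IsArtinian R M] (hp : 2 ≤ p)
    (hinj : Function.Injective F) : (specialPrimes R F).Finite := by
  have step : ∀ k : ℕ, ∃ T : Set (Ideal R), T.Finite ∧ T ⊆ specialPrimes R F ∧
      (∀ P ∈ T, ∀ Q ∈ specialPrimes R F, P ≤ Q → Q ∈ T) ∧
      ∀ P ∈ specialPrimes R F \ T,
        P.height + k ≤ (IsLocalRing.maximalIdeal R).height := by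
    intro k
    induction k with
    | zero =>
      refine ⟨∅, Set.finite_empty, Set.empty_subset _, by simp, fun P hP => ?_⟩
      simpa using Ideal.height_mono (IsLocalRing.le_maximalIdeal hP.1.1.ne_top)
    | succ k ih =>
      obtain ⟨T, hT, hTs, hup, hht⟩ := ih
      refine ⟨T ∪ {P | Maximal (· ∈ specialPrimes R F \ T) P},
        hT.union (finite_maximal_specialPrimes hF hp hinj hT hup),
        Set.union_subset hTs fun P hP => hP.1.1, ?_, ?_⟩
      · rintro P (hP | hP) Q hQ hPQ
        · exact Or.inl (hup P hP Q hQ hPQ)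
        · by_cases hQT : Q ∈ T
          · exact Or.inl hQT
          · right
            have : Q = P := le_antisymm (hP.2 ⟨hQ, hQT⟩ hPQ) hPQ
            rwa [this]
      · rintro P ⟨hP, hPT⟩
        have hP' : P ∈ specialPrimes R F \ T := ⟨hP, fun h => hPT (Or.inl h)⟩
        have hnm : ¬ Maximal (· ∈ specialPrimes R F \ T) P := fun h => hPT (Or.inr h)
        obtain ⟨Q, hPQ, hQ⟩ := exists_gt_of_not_maximal hP' hnm
        have := hP.1
        have := hQ.1.1
        have h1 := Ideal.height_add_one_le_of_lt_of_isPrime hPQ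
        calc P.height + ((k + 1 : ℕ) : ℕ∞) = (P.height + 1) + k := by push_cast; ring
          _ ≤ Q.height + k := by gcongr
          _ ≤ _ := hht Q hQ
  obtain ⟨n, hn⟩ := ENat.ne_top_iff_exists.1
    (Ideal.height_ne_top (Ideal.IsPrime.ne_top' (I := IsLocalRing.maximalIdeal R)))
  obtain ⟨T, hT, hTs, -, hht⟩ := step (n + 1)
  refine hT.subset fun P hP => ?_
  by_contra hPT
  have := hht P ⟨hP, hPT⟩
  rw [← hn] at this
  have h2 : ((n + 1 : ℕ) : ℕ∞) ≤ n := le_trans le_add_self this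
  have := ENat.natCast_le_natCast.1 h2
  lia

end FrobeniusAction

section SystemsOfParameters

variable {R : Type*} [CommRing R]

/-- The ideal generated by the elements of a multiset. -/
def msetIdeal (s : Multiset R) : Ideal R := Ideal.span {a | a ∈ s}

lemma msetIdeal_cons (a : R) (w : Multiset R) :
    msetIdeal (a ::ₘ w) = Ideal.span (insert a {b | b ∈ w}) := by
  rw [msetIdeal, show {b | b ∈ a ::ₘ w} = insert a {b | b ∈ w} from
    Set.ext fun b => Multiset.mem_cons]

lemma mem_msetIdeal_cons {a r : R} {w : Multiset R} :
    r ∈ msetIdeal (a ::ₘ w) ↔ ∃ u, r - u * a ∈ msetIdeal w := by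
  rw [msetIdeal_cons, Ideal.mem_span_insert]
  constructor
  · rintro ⟨u, z, hz, rfl⟩
    exact ⟨u, by rwa [add_sub_cancel_left]⟩
  · rintro ⟨u, hu⟩
    exact ⟨u, _, hu, by ring⟩

lemma mem_msetIdeal {a : R} {s : Multiset R} (h : a ∈ s) : a ∈ msetIdeal s :=
  Ideal.subset_span h

lemma msetIdeal_le {s : Multiset R} {I : Ideal R} : msetIdeal s ≤ I ↔ ∀ a ∈ s, a ∈ I :=
  Ideal.span_le

lemma msetIdeal_le_cons (a : R) (w : Multiset R) : msetIdeal w ≤ msetIdeal (a ::ₘ w) :=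
  msetIdeal_le.2 fun _ hb => mem_msetIdeal (Multiset.mem_cons_of_mem hb)

lemma isWeaklyRegular_concat_iff (l : List R) (a : R) :
    RingTheory.Sequence.IsWeaklyRegular R (l ++ [a]) ↔
      RingTheory.Sequence.IsWeaklyRegular R l ∧
        ∀ r, a * r ∈ msetIdeal (l : Multiset R) → r ∈ msetIdeal (l : Multiset R) := by
  rw [RingTheory.Sequence.isWeaklyRegular_append_iff,
    RingTheory.Sequence.isWeaklyRegular_singleton_iff, isSMulRegular_iff_right_eq_zero_of_smul]
  refine and_congr_right fun _ => ?_
  have hI : (Ideal.ofList l • ⊤ : Submodule R R) = msetIdeal (l : Multiset R) := by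
    rw [smul_eq_mul, Ideal.mul_top]; rfl
  rw [hI]
  constructor
  · intro h r hr
    have := h (Submodule.Quotient.mk r) (by
      rw [← Submodule.Quotient.mk_smul, Submodule.Quotient.mk_eq_zero]; exact hr)
    rwa [Submodule.Quotient.mk_eq_zero] at this
  · intro h x hx
    obtain ⟨r, rfl⟩ := Submodule.Quotient.mk_surjective _ x
    rw [← Submodule.Quotient.mk_smul, Submodule.Quotient.mk_eq_zero] at hx
    rw [Submodule.Quotient.mk_eq_zero]
    exact h r hx

/-- A multiset is a system of parameters. -/
def IsSop [IsLocalRing R] (s : Multiset R) : Prop :=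
  ((s.card : ℕ) : WithBot ℕ∞) = ringKrullDim R ∧
    (msetIdeal s).radical = IsLocalRing.maximalIdeal R

variable [IsLocalRing R]

lemma IsSop.mem_maximalIdeal {s : Multiset R} (hs : IsSop s) {a : R} (ha : a ∈ s) :
    a ∈ IsLocalRing.maximalIdeal R :=
  hs.2 ▸ Ideal.le_radical (mem_msetIdeal ha)

lemma IsSop.exchange {a b : R} {w : Multiset R} (h : IsSop (a ::ₘ w))
    (hb : b ∈ IsLocalRing.maximalIdeal R) {k : ℕ} (hk : a ^ k ∈ msetIdeal (b ::ₘ w)) :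
    IsSop (b ::ₘ w) := by
  refine ⟨by simpa using h.1, le_antisymm ?_ ?_⟩
  · refine (IsLocalRing.maximalIdeal.isMaximal R).isPrime.isRadical.radical_le_iff.2 ?_
    refine msetIdeal_le.2 fun c hc => ?_
    rcases Multiset.mem_cons.1 hc with rfl | hc
    · exact hb
    · exact h.mem_maximalIdeal (Multiset.mem_cons_of_mem hc)
  · rw [← h.2]
    refine (Ideal.radical_isRadical _).radical_le_iff.2 (msetIdeal_le.2 fun c hc => ?_)
    rcases Multiset.mem_cons.1 hc with rfl | hc
    · exact ⟨k, hk⟩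
    · exact Ideal.le_radical (mem_msetIdeal (Multiset.mem_cons_of_mem hc))

lemma IsSop.pow_cons {a : R} {w : Multiset R} (h : IsSop (a ::ₘ w)) {k : ℕ} (hk : k ≠ 0) :
    IsSop (a ^ k ::ₘ w) :=
  h.exchange (Ideal.pow_mem_of_mem _ (h.mem_maximalIdeal (Multiset.mem_cons_self a w)) _
    (Nat.pos_of_ne_zero hk)) (mem_msetIdeal (Multiset.mem_cons_self _ _))

lemma IsSop.of_mul_cons {f g : R} {w : Multiset R} (h : IsSop (f * g ::ₘ w))
    (hf : f ∈ IsLocalRing.maximalIdeal R) : IsSop (f ::ₘ w) :=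
  h.exchange (k := 1) hf (by
    rw [pow_one]
    exact Ideal.mul_mem_right _ _ (mem_msetIdeal (Multiset.mem_cons_self f w)))

lemma IsSop.exists_pow_sub_mem {a b : R} {w : Multiset R} (ha : a ∈ IsLocalRing.maximalIdeal R)
    (hb : IsSop (b ::ₘ w)) : ∃ k ≠ 0, ∃ c, a ^ k - c * b ∈ msetIdeal w := by
  rw [← hb.2] at ha
  obtain ⟨k, hk⟩ := ha
  obtain ⟨c, hc⟩ := mem_msetIdeal_cons.1 (Ideal.mul_mem_left _ a hk)
  exact ⟨k + 1, by simp, c, by rwa [pow_succ']⟩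

variable [IsNoetherianRing R]

lemma IsSop.maximalIdeal_notMem_minimalPrimes {a : R} {w : Multiset R} (h : IsSop (a ::ₘ w)) :
    IsLocalRing.maximalIdeal R ∉ (msetIdeal w).minimalPrimes := by
  classical
  intro hmem
  have h1 := Ideal.height_le_spanRank_toENat_of_mem_minimalPrimes _ _ hmem
  have h2 : (msetIdeal w).spanRank.toENat ≤ (w.card : ℕ∞) := by
    rw [Submodule.spanRank_toENat_eq_iInf_finset_card]
    refine (iInf_le _ ⟨w.toFinset, ?_⟩).trans (by exact_mod_cast Multiset.toFinset_card_le w)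
    rw [msetIdeal]
    congr 1
    exact Set.ext fun b => by simp
  have h3 := h.1
  rw [← IsLocalRing.maximalIdeal_height_eq_ringKrullDim, Multiset.card_cons] at h3
  have h4 : ((w.card + 1 : ℕ) : ℕ∞) = (IsLocalRing.maximalIdeal R).height := by exact_mod_cast h3
  have h5 : ((w.card + 1 : ℕ) : ℕ∞) ≤ (w.card : ℕ∞) := h4 ▸ h1.trans h2
  have := ENat.natCast_le_natCast.1 h5
  lia

lemma IsSop.cons_of_notMem_minimalPrimes {a z : R} {w : Multiset R} (h : IsSop (a ::ₘ w))
    (hz : z ∈ IsLocalRing.maximalIdeal R) (hz' : ∀ Q ∈ (msetIdeal w).minimalPrimes, z ∉ Q) :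
    IsSop (z ::ₘ w) := by
  have key : a ∈ (msetIdeal (z ::ₘ w)).radical := by
    rw [Ideal.radical_eq_sInf, Submodule.mem_sInf]
    rintro P ⟨hP, hPprime⟩
    by_contra haP
    have hlt : P < IsLocalRing.maximalIdeal R :=
      lt_of_le_of_ne (IsLocalRing.le_maximalIdeal hPprime.ne_top) fun heq =>
        haP (heq ▸ h.mem_maximalIdeal (Multiset.mem_cons_self a w))
    have hmin : IsLocalRing.maximalIdeal R ∈
        (Ideal.span (insert a {b | b ∈ w})).minimalPrimes := by
      rw [← msetIdeal_cons, ← Ideal.radical_minimalPrimes, h.2,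
        Ideal.minimalPrimes_eq_subsingleton_self]
      rfl
    refine hz' P (Ideal.mem_minimalPrimes_span_of_mem_minimalPrimes_span_insert hlt a _ hmin
      {b | b ∈ w} (fun b hb => hP (mem_msetIdeal (Multiset.mem_cons_of_mem hb)))
      fun b hb => Ideal.le_radical (Ideal.subset_span (Or.inr hb)))
      (hP (mem_msetIdeal (Multiset.mem_cons_self z w)))
  obtain ⟨k, hk⟩ := key
  exact h.exchange hz hk

lemma exists_isSop_cons {a b : R} {v w : Multiset R} (ha : IsSop (a ::ₘ v))
    (hb : IsSop (b ::ₘ w)) : ∃ z, IsSop (z ::ₘ v) ∧ IsSop (z ::ₘ w) := by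
  have hfin := ((msetIdeal v).finite_minimalPrimes_of_isNoetherianRing R).union
    ((msetIdeal w).finite_minimalPrimes_of_isNoetherianRing R)
  by_cases hsub : ((IsLocalRing.maximalIdeal R : Ideal R) : Set R) ⊆
      ⋃ Q ∈ (hfin.toFinset : Set (Ideal R)), (Q : Set R)
  · exfalso
    have hprime : ∀ Q ∈ hfin.toFinset, Q.IsPrime := by
      intro Q hQ
      rcases hfin.mem_toFinset.1 hQ with hQ | hQ
      exacts [hQ.isPrime, hQ.isPrime]
    obtain ⟨Q, hQ, hle⟩ := (Ideal.subset_union_prime (f := id) ⊤ ⊤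
      fun Q hQ _ _ => hprime Q hQ).1 hsub
    have heq : IsLocalRing.maximalIdeal R = Q :=
      le_antisymm hle (IsLocalRing.le_maximalIdeal (hprime Q hQ).ne_top)
    rcases hfin.mem_toFinset.1 hQ with hQ | hQ
    exacts [ha.maximalIdeal_notMem_minimalPrimes (heq ▸ hQ),
      hb.maximalIdeal_notMem_minimalPrimes (heq ▸ hQ)]
  · obtain ⟨z, hz, hz'⟩ := Set.not_subset.1 hsub
    simp only [Set.mem_iUnion, not_exists] at hz'
    exact ⟨z, ha.cons_of_notMem_minimalPrimes hz fun Q hQ => hz' Q (by simp [hQ]),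
      hb.cons_of_notMem_minimalPrimes hz fun Q hQ => hz' Q (by simp [hQ])⟩

/-- Any two systems of parameters are connected by exchanging one element at a time. -/
lemma IsSop.exchange_induction {C : Multiset R → Prop}
    (hC : ∀ a b w, IsSop (a ::ₘ w) → IsSop (b ::ₘ w) → C (a ::ₘ w) → C (b ::ₘ w))
    {s t : Multiset R} (hs : IsSop s) (ht : IsSop t) (h : C s) : C t := by
  have main : ∀ (s t u : Multiset R), s.card = t.card → IsSop (s + u) → IsSop (t + u) →
      C (s + u) → C (t + u) := by
    intro s
    induction s using Multiset.induction with
    | empty =>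
      intro t u hcard _ _ h
      rw [Multiset.card_eq_zero.1 hcard.symm]
      exact h
    | cons a s ih =>
      intro t u hcard hs ht h
      obtain ⟨b, t, rfl⟩ : ∃ b t', t = b ::ₘ t' := by
        obtain ⟨b, hb⟩ := Multiset.card_pos_iff_exists_mem.1
          (show 0 < t.card by rw [← hcard, Multiset.card_cons]; lia)
        obtain ⟨t', ht'⟩ := Multiset.exists_cons_of_mem hb
        exact ⟨b, t', ht'⟩
      rw [Multiset.cons_add] at hs ht h ⊢
      obtain ⟨z, hz, hz'⟩ := exists_isSop_cons hs ht
      refine hC _ _ _ hz' ht ?_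
      have := ih t (z ::ₘ u) (by simpa using hcard)
      simp only [Multiset.add_cons] at this
      exact this hz hz' (hC _ _ _ hs hz h)
  have hcard : s.card = t.card := by
    have := hs.1.trans ht.1.symm
    exact_mod_cast this
  simpa using main s t 0 hcard (by simpa using hs) (by simpa using ht) (by simpa using h)

/-- In a Noetherian local ring in which some system of parameters is a regular sequence, each
element of a system of parameters is a nonzerodivisor modulo the others. -/
theorem IsSop.mem_of_mul_mem {x : List R} (hx : IsSop (x : Multiset R))
    (hreg : RingTheory.Sequence.IsWeaklyRegular R x) {a : R} {w : Multiset R}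
    (h : IsSop (a ::ₘ w)) {r : R} (hr : a * r ∈ msetIdeal w) : r ∈ msetIdeal w := by
  let C : Multiset R → Prop := fun s => ∀ l : List R, (l : Multiset R) = s →
    RingTheory.Sequence.IsWeaklyRegular R l
  have perm : ∀ l l' : List R, IsSop (l : Multiset R) → (l : Multiset R) = l' →
      RingTheory.Sequence.IsWeaklyRegular R l → RingTheory.Sequence.IsWeaklyRegular R l' :=
    fun l l' hl hll' hreg => IsLocalRing.isWeaklyRegular_of_perm_of_subset_maximalIdeal hreg
      (Multiset.coe_eq_coe.1 hll') fun r hr => hl.mem_maximalIdeal (Multiset.mem_coe.2 hr)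
  have hconcat : ∀ (b : R) (v : Multiset R), ((v.toList ++ [b] : List R) : Multiset R) = b ::ₘ v :=
    fun b v => by
      rw [← Multiset.coe_add, Multiset.coe_toList, Multiset.coe_singleton, add_comm,
        Multiset.singleton_add]
  have hstep : ∀ a b w, IsSop (a ::ₘ w) → IsSop (b ::ₘ w) → C (a ::ₘ w) → C (b ::ₘ w) := by
    intro a b w ha hb hC l hl
    obtain ⟨h1, h2⟩ := (isWeaklyRegular_concat_iff _ _).1 (hC _ (hconcat a w))
    refine perm (w.toList ++ [b]) l (by rwa [hconcat]) ((hconcat b w).trans hl.symm)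
      ((isWeaklyRegular_concat_iff _ _).2 ⟨h1, ?_⟩)
    rw [Multiset.coe_toList] at h2 ⊢
    intro r hr
    obtain ⟨k, -, c, hc⟩ := hb.exists_pow_sub_mem (ha.mem_maximalIdeal (Multiset.mem_cons_self a w))
    have hpow : a ^ k * r ∈ msetIdeal w := by
      rw [show a ^ k * r = (a ^ k - c * b) * r + c * (b * r) by ring]
      exact add_mem (Ideal.mul_mem_right _ _ hc) (Ideal.mul_mem_left _ _ hr)
    clear hc
    induction k with
    | zero => simpa using hpow
    | succ k ih => exact ih (h2 _ (by rwa [← mul_assoc, ← pow_succ']))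
  have hCx : C x := fun l hl => perm x l hx hl.symm hreg
  have := (isWeaklyRegular_concat_iff _ _).1
    (IsSop.exchange_induction hstep hx h hCx _ (hconcat a w))
  rw [Multiset.coe_toList] at this
  exact this.2 r hr

end SystemsOfParameters

section ArtinianCriterion

variable {R M : Type*} [CommRing R] [AddCommGroup M] [Module R M]

/-- The submodule of elements annihilated by all members of a multiset. -/
def torsionByMset (M : Type*) [AddCommGroup M] [Module R M] (s : Multiset R) : Submodule R M where
  carrier := {m | ∀ a ∈ s, a • m = 0}
  add_mem' hx hy a ha := by rw [smul_add, hx a ha, hy a ha, add_zero]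
  zero_mem' _ _ := smul_zero _
  smul_mem' r m hm a ha := by rw [smul_comm, hm a ha, smul_zero]

/-- A module on which some `a` acts nilpotently elementwise is Artinian if the submodule
killed by `a` is. -/
theorem isArtinian_of_isArtinian_ker_lsmul_s13 (a : R) (htors : ∀ m : M, ∃ n : ℕ, a ^ n • m = 0)
    [IsArtinian R (LinearMap.ker (LinearMap.lsmul R M a))] : IsArtinian R M := by
  set K := LinearMap.ker (LinearMap.lsmul R M a) with hK
  let G : Submodule R M → ℕ → Submodule R K := fun N k =>
    (N.map (LinearMap.lsmul R M (a ^ k))).comap K.subtype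
  have hG : ∀ {N N' : Submodule R M} {k l : ℕ}, N' ≤ N → k ≤ l → G N' l ≤ G N k := by
    intro N N' k l hN hkl x hx
    obtain ⟨n, hn, hnx⟩ := hx
    obtain ⟨d, rfl⟩ := Nat.exists_eq_add_of_le hkl
    refine ⟨a ^ d • n, N.smul_mem _ (hN hn), ?_⟩
    rw [← hnx, LinearMap.lsmul_apply, LinearMap.lsmul_apply, pow_add, mul_smul]
  have hle : ∀ {N N' : Submodule R M}, N' ≤ N → (∀ k, G N k ≤ G N' k) → N ≤ N' := by
    intro N N' hN hNN'
    have main : ∀ k, ∀ n ∈ N, a ^ k • n = 0 → n ∈ N' := by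
      intro k
      induction k with
      | zero =>
        intro n _ h0
        rw [pow_zero, one_smul] at h0
        rw [h0]; exact zero_mem _
      | succ k ih =>
        intro n hn h0
        have hmem : a ^ k • n ∈ K := by
          rw [hK, LinearMap.mem_ker, LinearMap.lsmul_apply, ← mul_smul, ← pow_succ', h0]
        obtain ⟨n', hn', hnn'⟩ := hNN' k (show (⟨a ^ k • n, hmem⟩ : K) ∈ G N k from ⟨n, hn, rfl⟩)
        have hnn'' : a ^ k • n' = a ^ k • n := hnn'
        have := ih (n - n') (sub_mem hn (hN hn')) (by rw [smul_sub, hnn'', sub_self])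
        simpa using add_mem this hn'
    intro n hn
    obtain ⟨k, hk⟩ := htors n
    exact main k n hn hk
  rw [← monotone_stabilizes_iff_artinian]
  intro f
  have hf : ∀ {i j : ℕ}, i ≤ j → OrderDual.ofDual (f j) ≤ OrderDual.ofDual (f i) :=
    fun hij => f.monotone hij
  let g : ℕ → Submodule R M := fun i => OrderDual.ofDual (f i)
  obtain ⟨J, hJ⟩ := IsArtinian.monotone_stabilizes (R := R) (M := K)
    ⟨fun j => OrderDual.toDual (G (g j) j), fun i j hij => hG (hf hij) hij⟩
  have hcol : ∀ k, ∃ n, ∀ m, n ≤ m → G (g n) k = G (g m) k := fun k =>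
    IsArtinian.monotone_stabilizes (R := R) (M := K)
      ⟨fun j => OrderDual.toDual (G (g j) k), fun i j hij => hG (hf hij) le_rfl⟩
  choose n hn using hcol
  let L := max J ((Finset.range J).sup n)
  refine ⟨L, fun m hm => le_antisymm (f.monotone hm) ?_⟩
  refine hle (hf hm) fun k => ?_
  by_cases hk : k < J
  · have h1 : n k ≤ L := (Finset.le_sup (Finset.mem_range.2 hk)).trans (le_max_right _ _)
    exact ((hn k L h1).symm.trans (hn k m (h1.trans hm))).le
  · have hJL : J ≤ L := le_max_left _ _
    have h2 : G (g J) J = G (g (max m k)) (max m k) :=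
      hJ _ (le_max_of_le_right (by lia))
    calc G (g L) k ≤ G (g J) J := hG (hf hJL) (by lia)
      _ = G (g (max m k)) (max m k) := h2
      _ ≤ G (g m) k := hG (hf (le_max_left _ _)) (le_max_right _ _)

theorem isArtinian_of_isArtinian_torsionByMset (s : Multiset R)
    (htors : ∀ a ∈ s, ∀ m : M, ∃ n : ℕ, a ^ n • m = 0) (hs : IsArtinian R (torsionByMset M s)) :
    IsArtinian R M := by
  induction s using Multiset.induction with
  | empty =>
    exact isArtinian_of_surjective _ (torsionByMset M (0 : Multiset R)).subtype
      fun m => ⟨⟨m, fun a ha => absurd ha (Multiset.notMem_zero a)⟩, rfl⟩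
  | cons a s ih =>
    refine ih (fun b hb => htors b (Multiset.mem_cons_of_mem hb)) ?_
    let f : LinearMap.ker (LinearMap.lsmul R (torsionByMset M s) a) →ₗ[R]
        torsionByMset M (a ::ₘ s) :=
      ((torsionByMset M s).subtype.comp (Submodule.subtype _)).codRestrict _ (by
        rintro ⟨m, hm⟩ b hb
        rcases Multiset.mem_cons.1 hb with rfl | hb
        · exact congrArg Subtype.val (LinearMap.mem_ker.1 hm)
        · exact m.2 b hb)
    have : IsArtinian R (LinearMap.ker (LinearMap.lsmul R (torsionByMset M s) a)) :=
      isArtinian_of_injective f fun x y hxy => by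
        have : ((f x : torsionByMset M (a ::ₘ s)) : M) = f y := congrArg Subtype.val hxy
        exact Subtype.ext (Subtype.ext this)
    refine isArtinian_of_isArtinian_ker_lsmul_s13 a fun m => ?_
    obtain ⟨n, hn⟩ := htors a (Multiset.mem_cons_self a s) m
    exact ⟨n, Subtype.ext hn⟩

end ArtinianCriterion

section ParameterColon

variable {R : Type*} [CommRing R]

lemma bracketPow_msetIdeal (p : ℕ) [Fact p.Prime] [CharP R p] (s : Multiset R) (e : ℕ) :
    bracketPow (msetIdeal s) (p ^ e) = msetIdeal (s.map (· ^ p ^ e)) := by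
  have h1 : bracketPow (msetIdeal s) (p ^ e) = (msetIdeal s).map (iterateFrobenius R p e) := rfl
  rw [h1, msetIdeal, Ideal.map_span, msetIdeal]
  congr 1
  ext b
  simp [iterateFrobenius_def]

variable [IsLocalRing R]

/-- In `R`, each element of a system of parameters is a nonzerodivisor modulo the others. -/
def SopRegular (R : Type*) [CommRing R] [IsLocalRing R] : Prop :=
  ∀ ⦃a : R⦄ ⦃w : Multiset R⦄ ⦃r : R⦄, IsSop (a ::ₘ w) → a * r ∈ msetIdeal w → r ∈ msetIdeal w

lemma SopRegular.mul_mem_iff_cons_of_sub_mem (hR : SopRegular R) {f g z r : R} {w : Multiset R}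
    (h : IsSop (z ::ₘ w)) (hz : z - f * g ∈ msetIdeal w) :
    g * r ∈ msetIdeal (z ::ₘ w) ↔ r ∈ msetIdeal (f ::ₘ w) := by
  simp only [mem_msetIdeal_cons]
  refine exists_congr fun u => ⟨fun hu => hR h ?_, fun hu => ?_⟩
  · rw [show z * (r - u * f) = f * (g * r - u * z) + r * (z - f * g) by ring]
    exact add_mem (Ideal.mul_mem_left _ _ hu) (Ideal.mul_mem_left _ _ hz)
  · rw [show g * r - u * z = g * (r - u * f) - u * (z - f * g) by ring]
    exact sub_mem (Ideal.mul_mem_left _ _ hu) (Ideal.mul_mem_left _ _ hz)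

lemma SopRegular.mul_mem_iff_cons (hR : SopRegular R) {f g r : R} {w : Multiset R}
    (h : IsSop (f * g ::ₘ w)) :
    g * r ∈ msetIdeal (f * g ::ₘ w) ↔ r ∈ msetIdeal (f ::ₘ w) :=
  hR.mul_mem_iff_cons_of_sub_mem h (by rw [sub_self]; exact zero_mem _)

lemma SopRegular.prod_mul_mem_iff_add (hR : SopRegular R) (P : Multiset (R × R))
    (hP : ∀ q ∈ P, q.1 ∈ IsLocalRing.maximalIdeal R) (u : Multiset R) (r : R)
    (h : IsSop (P.map (fun q => q.1 * q.2) + u)) :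
    (P.map Prod.snd).prod * r ∈ msetIdeal (P.map (fun q => q.1 * q.2) + u) ↔
      r ∈ msetIdeal (P.map Prod.fst + u) := by
  induction P using Multiset.induction generalizing u with
  | empty => simp
  | cons q P ih =>
    simp only [Multiset.map_cons, Multiset.prod_cons, Multiset.cons_add, mul_assoc] at h ⊢
    rw [hR.mul_mem_iff_cons h]
    have h' := h.of_mul_cons (hP q (Multiset.mem_cons_self _ _))
    rw [← Multiset.add_cons] at h'
    rw [← Multiset.add_cons, ← Multiset.add_cons]
    exact ih (fun q hq => hP q (Multiset.mem_cons_of_mem hq)) _ h'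

lemma SopRegular.prod_mul_mem_iff (hR : SopRegular R) (P : Multiset (R × R))
    (hP : ∀ q ∈ P, q.1 ∈ IsLocalRing.maximalIdeal R) (r : R)
    (h : IsSop (P.map (fun q => q.1 * q.2))) :
    (P.map Prod.snd).prod * r ∈ msetIdeal (P.map (fun q => q.1 * q.2)) ↔
      r ∈ msetIdeal (P.map Prod.fst) := by
  simpa using hR.prod_mul_mem_iff_add P hP 0 r (by simpa using h)

lemma IsSop.map_pow_add (P : Multiset (R × ℕ)) (hP : ∀ q ∈ P, q.2 ≠ 0) (u : Multiset R)
    (h : IsSop (P.map Prod.fst + u)) : IsSop (P.map (fun q => q.1 ^ q.2) + u) := by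
  induction P using Multiset.induction generalizing u with
  | empty => simpa using h
  | cons q P ih =>
    simp only [Multiset.map_cons, Multiset.cons_add] at h ⊢
    have h' := h.pow_cons (hP q (Multiset.mem_cons_self _ _))
    rw [← Multiset.add_cons] at h' ⊢
    exact ih (fun q hq => hP q (Multiset.mem_cons_of_mem hq)) _ h'

lemma IsSop.map_pow' {P : Multiset (R × ℕ)} (h : IsSop (P.map Prod.fst))
    (hP : ∀ q ∈ P, q.2 ≠ 0) : IsSop (P.map (fun q => q.1 ^ q.2)) := by
  simpa using IsSop.map_pow_add P hP 0 (by simpa using h)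

lemma IsSop.map_pow {s : Multiset R} (h : IsSop s) {t : ℕ} (ht : t ≠ 0) :
    IsSop (s.map (· ^ t)) := by
  have := IsSop.map_pow' (P := s.map fun a => (a, t)) (by simpa using h)
    (by simp only [Multiset.mem_map]; rintro _ ⟨a, -, rfl⟩; exact ht)
  simpa using this

/-- An element multiplied into the ideal `(aᵗ : a ∈ v) + (u)` by every member of `v` is, modulo
that ideal, a multiple of `∏ aᵗ⁻¹`. -/
lemma SopRegular.exists_sub_prod_pow_mul_mem_add (hR : SopRegular R) {t : ℕ} (ht : t ≠ 0)
    (v : Multiset R) (u : Multiset R) (r : R) (h : IsSop (v.map (· ^ t) + u))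
    (hr : ∀ a ∈ v, a * r ∈ msetIdeal (v.map (· ^ t) + u))
    (hv : ∀ a ∈ v, a ∈ IsLocalRing.maximalIdeal R) :
    ∃ r', r - v.prod ^ (t - 1) * r' ∈ msetIdeal (v.map (· ^ t) + u) := by
  induction v using Multiset.induction generalizing u r with
  | empty => exact ⟨r, by simp⟩
  | cons a v ih =>
    obtain ⟨k, rfl⟩ := Nat.exists_eq_succ_of_ne_zero ht
    simp only [Multiset.map_cons, Multiset.cons_add, Multiset.prod_cons, Nat.succ_eq_add_one,
      add_tsub_cancel_right] at h hr ⊢ ih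
    set w := v.map (· ^ (k + 1)) + u with hw
    have h0 : IsSop (a ^ k * a ::ₘ w) := by rwa [← pow_succ]
    have h1 : IsSop (a * a ^ k ::ₘ w) := by rwa [← pow_succ']
    have ha : IsSop (a ::ₘ w) := h1.of_mul_cons (hv a (Multiset.mem_cons_self a v))
    have har := hr a (Multiset.mem_cons_self a v)
    rw [pow_succ, hR.mul_mem_iff_cons h0, mem_msetIdeal_cons] at har
    obtain ⟨r₁, hr₁⟩ := har
    obtain ⟨r₂, hr₂⟩ := ih (a ::ₘ u) r₁ (by rw [Multiset.add_cons]; exact ha)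
      (fun b hb => by
        rw [Multiset.add_cons, ← hR.mul_mem_iff_cons h1, ← pow_succ']
        rw [show a ^ k * (b * r₁) = b * r - b * (r - r₁ * a ^ k) by ring]
        exact sub_mem (hr b (Multiset.mem_cons_of_mem hb))
          (Ideal.mul_mem_left _ _ (msetIdeal_le_cons _ _ hr₁)))
      (fun b hb => hv b (Multiset.mem_cons_of_mem hb))
    rw [Multiset.add_cons, ← hR.mul_mem_iff_cons h1, ← pow_succ'] at hr₂
    refine ⟨r₂, ?_⟩
    rw [show r - (a * v.prod) ^ k * r₂ = (r - r₁ * a ^ k) + a ^ k * (r₁ - v.prod ^ k * r₂) by ring]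
    exact add_mem (msetIdeal_le_cons _ _ hr₁) hr₂

lemma SopRegular.exists_sub_prod_pow_mul_mem (hR : SopRegular R) {t : ℕ} (ht : t ≠ 0)
    {s : Multiset R} (hs : IsSop s) (r : R) (hr : ∀ a ∈ s, a * r ∈ msetIdeal (s.map (· ^ t))) :
    ∃ r', r - s.prod ^ (t - 1) * r' ∈ msetIdeal (s.map (· ^ t)) := by
  simpa using hR.exists_sub_prod_pow_mul_mem_add ht s 0 r (by simpa using hs.map_pow ht)
    (by simpa using hr) fun a ha => hs.mem_maximalIdeal ha

/-- Multiplication by `∏ aᵏ` embeds `R / (aᵗ)` into `R / (aᵗ⁺ᵏ)`. -/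
lemma SopRegular.prod_pow_mul_mem_iff (hR : SopRegular R) {s : Multiset R} (hs : IsSop s)
    {t : ℕ} (ht : t ≠ 0) (k : ℕ) (r : R) :
    s.prod ^ k * r ∈ msetIdeal (s.map (· ^ (t + k))) ↔ r ∈ msetIdeal (s.map (· ^ t)) := by
  have := hR.prod_mul_mem_iff (s.map fun a => (a ^ t, a ^ k)) (by
    simp only [Multiset.mem_map]
    rintro _ ⟨a, ha, rfl⟩
    exact Ideal.pow_mem_of_mem _ (hs.mem_maximalIdeal ha) _ (Nat.pos_of_ne_zero ht)) r
    (by simpa [← pow_add] using hs.map_pow (by lia : t + k ≠ 0))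
  simpa [← pow_add, Multiset.prod_map_pow] using this

end ParameterColon

section TopLocalCohomology

variable {R : Type*} [CommRing R]

lemma prod_pow_mul_mem {s : Multiset R} {t : ℕ} (k : ℕ) {r : R}
    (hr : r ∈ msetIdeal (s.map (· ^ t))) : s.prod ^ k * r ∈ msetIdeal (s.map (· ^ (t + k))) := by
  suffices msetIdeal (s.map (· ^ t)) ≤
      Submodule.comap (LinearMap.mulLeft R (s.prod ^ k))
        (msetIdeal (s.map (· ^ (t + k)))) from this hr
  refine msetIdeal_le.2 fun b hb => ?_
  obtain ⟨a, ha, rfl⟩ := Multiset.mem_map.1 hb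
  obtain ⟨c, hc⟩ := Multiset.dvd_prod ha
  rw [Submodule.mem_comap, LinearMap.mulLeft_apply, hc,
    show (a * c) ^ k * a ^ t = c ^ k * a ^ (t + k) by ring]
  exact Ideal.mul_mem_left _ _ (mem_msetIdeal (Multiset.mem_map_of_mem _ ha))

/-- The submodule of `R_π`, `π = ∏ s`, of fractions `r / πᵗ` with `r ∈ (aᵗ : a ∈ s)`. The quotient
of `R_π` by it is the top Čech cohomology module of `R` with respect to `s`. -/
def cechBoundaries (s : Multiset R) : Submodule R (Localization.Away s.prod) where
  carrier := {y | ∃ t ≠ 0, ∃ r ∈ msetIdeal (s.map (· ^ t)), s.prod ^ t • y = algebraMap R _ r}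
  zero_mem' := ⟨1, one_ne_zero, 0, zero_mem _, by simp⟩
  add_mem' := by
    rintro y y' ⟨t, ht, r, hr, hy⟩ ⟨t', ht', r', hr', hy'⟩
    refine ⟨t + t', by lia, s.prod ^ t' * r + s.prod ^ t * r',
      add_mem (prod_pow_mul_mem _ hr) ?_, ?_⟩
    · rw [add_comm t t']
      exact prod_pow_mul_mem _ hr'
    · rw [map_add, map_mul, map_mul, ← hy, ← hy', ← Algebra.smul_def, ← Algebra.smul_def, smul_smul,
        smul_smul, ← pow_add, ← pow_add, smul_add, add_comm t' t]
  smul_mem' := by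
    rintro c y ⟨t, ht, r, hr, hy⟩
    exact ⟨t, ht, c * r, Ideal.mul_mem_left _ _ hr, by
      rw [smul_comm, hy, map_mul, Algebra.smul_def]⟩

lemma exists_prod_pow_smul_eq (s : Multiset R) (y : Localization.Away s.prod) :
    ∃ t ≠ 0, ∃ r, s.prod ^ t • y = algebraMap R _ r := by
  obtain ⟨n, r, h⟩ := IsLocalization.Away.surj s.prod y
  refine ⟨n + 1, by simp, s.prod * r, ?_⟩
  rw [map_mul, ← h, Algebra.smul_def, map_pow]
  ring

lemma exists_smul_eq_algebraMap (s : Multiset R) (t : ℕ) (r : R) :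
    ∃ y : Localization.Away s.prod, s.prod ^ t • y = algebraMap R _ r := by
  refine ⟨algebraMap R _ r * IsLocalization.Away.invSelf s.prod ^ t, ?_⟩
  rw [Algebra.smul_def, map_pow, mul_left_comm, ← mul_pow, IsLocalization.Away.mul_invSelf, one_pow,
    mul_one]

/-- The Frobenius of `R_π` as a semilinear map. -/
def localizationFrobenius (p : ℕ) [Fact p.Prime] [CharP R p] (s : Multiset R) :
    Localization.Away s.prod →ₛₗ[frobenius R p] Localization.Away s.prod where
  toFun y := y ^ p
  map_add' y z := by
    have h0 : (p : Localization.Away s.prod) = 0 := by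
      rw [← map_natCast (algebraMap R _), CharP.cast_eq_zero, map_zero]
    rw [add_pow_prime_eq Fact.out, h0, zero_mul, zero_mul, zero_mul, add_zero]
  map_smul' r y := by rw [smul_pow, frobenius_def]

lemma map_pow_mul_eq (s : Multiset R) (t q : ℕ) :
    s.map (· ^ (t * q)) = (s.map (· ^ t)).map (· ^ q) := by
  simp [pow_mul]

variable (p : ℕ) [Fact p.Prime] [CharP R p]

lemma pow_mem_of_mem_msetIdeal {s : Multiset R} {t e : ℕ} {r : R}
    (hr : r ∈ msetIdeal (s.map (· ^ t))) : r ^ p ^ e ∈ msetIdeal (s.map (· ^ (t * p ^ e))) := by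
  rw [map_pow_mul_eq, ← bracketPow_msetIdeal]
  exact Ideal.subset_span ⟨r, hr, rfl⟩

lemma smul_pow_eq_of_smul_eq {s : Multiset R} {t : ℕ} (q : ℕ) {r : R}
    {y : Localization.Away s.prod} (h : s.prod ^ t • y = algebraMap R _ r) :
    s.prod ^ (t * q) • y ^ q = algebraMap R _ (r ^ q) := by
  rw [pow_mul, ← smul_pow, h, map_pow]

lemma cechBoundaries_le_comap (s : Multiset R) :
    cechBoundaries s ≤ (cechBoundaries s).comap (localizationFrobenius p s) := by
  rintro y ⟨t, ht, r, hr, hy⟩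
  refine ⟨t * p, mul_ne_zero ht (Fact.out : p.Prime).ne_zero, r ^ p, ?_,
    smul_pow_eq_of_smul_eq p hy⟩
  simpa using pow_mem_of_mem_msetIdeal p (e := 1) hr

/-- The Frobenius action on top Čech cohomology. -/
def cechFrobenius (s : Multiset R) :
    Localization.Away s.prod ⧸ cechBoundaries s →+ Localization.Away s.prod ⧸ cechBoundaries s :=
  ((cechBoundaries s).mapQ _ (localizationFrobenius p s)
    (cechBoundaries_le_comap p s)).toAddMonoidHom

lemma cechFrobenius_mk (s : Multiset R) (y : Localization.Away s.prod) :
    cechFrobenius p s (Submodule.Quotient.mk y) = Submodule.Quotient.mk (y ^ p) := rfl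

lemma cechFrobenius_smul (s : Multiset R) (r : R)
    (h : Localization.Away s.prod ⧸ cechBoundaries s) :
    cechFrobenius p s (r • h) = r ^ p • cechFrobenius p s h := by
  obtain ⟨y, rfl⟩ := Submodule.Quotient.mk_surjective _ h
  rw [← Submodule.Quotient.mk_smul, cechFrobenius_mk, cechFrobenius_mk, smul_pow,
    Submodule.Quotient.mk_smul]

lemma iterate_cechFrobenius_mk (s : Multiset R) (e : ℕ) (y : Localization.Away s.prod) :
    (cechFrobenius p s)^[e] (Submodule.Quotient.mk y) = Submodule.Quotient.mk (y ^ p ^ e) := by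
  induction e with
  | zero => simp
  | succ e ih => rw [Function.iterate_succ_apply', ih, cechFrobenius_mk, ← pow_mul, pow_succ]

variable [IsLocalRing R] {s : Multiset R}

lemma SopRegular.mem_cechBoundaries_iff (hR : SopRegular R) (hs : IsSop s) {t : ℕ} (ht : t ≠ 0)
    {r : R} {y : Localization.Away s.prod} (hy : s.prod ^ t • y = algebraMap R _ r) :
    y ∈ cechBoundaries s ↔ r ∈ msetIdeal (s.map (· ^ t)) := by
  refine ⟨?_, fun hr => ⟨t, ht, r, hr, hy⟩⟩
  rintro ⟨t', ht', r', hr', hy'⟩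
  have heq : algebraMap R (Localization.Away s.prod) (s.prod ^ t' * r) =
      algebraMap R _ (s.prod ^ t * r') := by
    rw [map_mul, map_mul, ← hy, ← hy', ← Algebra.smul_def, ← Algebra.smul_def, smul_comm]
  obtain ⟨⟨_, k, rfl⟩, hk⟩ := IsLocalization.exists_of_eq (M := Submonoid.powers s.prod) heq
  dsimp only at hk
  rw [← hR.prod_pow_mul_mem_iff hs ht (t' + k), show s.prod ^ (t' + k) * r =
    s.prod ^ k * (s.prod ^ t' * r) by ring, hk, ← mul_assoc, ← pow_add, show t + (t' + k) =
    t' + (k + t) by ring]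
  exact prod_pow_mul_mem _ hr'

lemma SopRegular.smul_iterate_cechFrobenius_eq_zero_iff (hR : SopRegular R) (hs : IsSop s) {t : ℕ}
    (ht : t ≠ 0) {r : R} {y : Localization.Away s.prod} (hy : s.prod ^ t • y = algebraMap R _ r)
    (c : R) (e : ℕ) :
    c • (cechFrobenius p s)^[e] (Submodule.Quotient.mk y) = 0 ↔
      c * r ^ p ^ e ∈ msetIdeal (s.map (· ^ (t * p ^ e))) := by
  rw [iterate_cechFrobenius_mk, ← Submodule.Quotient.mk_smul, Submodule.Quotient.mk_eq_zero]
  refine hR.mem_cechBoundaries_iff hs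
    (mul_ne_zero ht (pow_ne_zero _ (Fact.out : p.Prime).ne_zero)) ?_
  rw [smul_comm, smul_pow_eq_of_smul_eq _ hy, map_mul, Algebra.smul_def]

lemma IsSop.isParameterIdeal (hs : IsSop s) : IsParameterIdeal (msetIdeal s) := by
  refine ⟨s.toList.length, s.toList.get, by rw [Multiset.length_toList, hs.1], ?_, hs.2⟩
  rw [msetIdeal, Set.range_list_get]
  simp

lemma SopRegular.injective_cechFrobenius (hR : SopRegular R) (hs : IsSop s)
    (hfrob : ∀ J : Ideal R, IsParameterIdeal J → FrobeniusClosed p J) :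
    Function.Injective (cechFrobenius p s) := by
  rw [injective_iff_map_eq_zero]
  intro h hh
  obtain ⟨y, rfl⟩ := Submodule.Quotient.mk_surjective _ h
  obtain ⟨t, ht, r, hy⟩ := exists_prod_pow_smul_eq s y
  rw [Submodule.Quotient.mk_eq_zero, hR.mem_cechBoundaries_iff hs ht hy]
  refine hfrob _ (hs.map_pow ht).isParameterIdeal r ⟨1, ?_⟩
  rw [bracketPow_msetIdeal, ← map_pow_mul_eq]
  have := (hR.smul_iterate_cechFrobenius_eq_zero_iff p hs ht hy 1 1).1 (by simpa using hh)
  simpa using this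

lemma SopRegular.isArtinian_cech [IsNoetherianRing R] (hR : SopRegular R) (hs : IsSop s) :
    IsArtinian R (Localization.Away s.prod ⧸ cechBoundaries s) := by
  have hmin : IsLocalRing.maximalIdeal R ∈ (msetIdeal s).minimalPrimes := by
    rw [← Ideal.radical_minimalPrimes, hs.2, Ideal.minimalPrimes_eq_subsingleton_self]
    rfl
  have : IsArtinianRing (R ⧸ msetIdeal s) :=
    IsLocalRing.quotient_artinian_of_mem_minimalPrimes_of_isLocalRing _ hmin
  have : IsArtinian R (R ⧸ msetIdeal s) :=
    isArtinian_of_surjective_algebraMap (S := R) (R := R ⧸ msetIdeal s)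
      Ideal.Quotient.mk_surjective
  obtain ⟨y₀, hy₀⟩ := exists_smul_eq_algebraMap s 1 1
  have hr₀ : ∀ r : R, s.prod ^ 1 • (r • y₀) = algebraMap R _ r := fun r => by
    rw [smul_comm, hy₀, Algebra.smul_def, ← map_mul, mul_one]
  let f : R ⧸ msetIdeal s →ₗ[R] Localization.Away s.prod ⧸ cechBoundaries s :=
    (msetIdeal s).liftQ ((cechBoundaries s).mkQ.comp (LinearMap.toSpanSingleton R _ y₀)) (by
      intro r hr
      rw [LinearMap.mem_ker, LinearMap.comp_apply, LinearMap.toSpanSingleton_apply,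
        Submodule.mkQ_apply, Submodule.Quotient.mk_eq_zero,
        hR.mem_cechBoundaries_iff hs one_ne_zero (hr₀ r)]
      simpa using hr)
  refine isArtinian_of_isArtinian_torsionByMset s ?_ ?_
  · intro a ha h
    obtain ⟨y, rfl⟩ := Submodule.Quotient.mk_surjective _ h
    obtain ⟨t, ht, r, hy⟩ := exists_prod_pow_smul_eq s y
    refine ⟨t, ?_⟩
    rw [← Submodule.Quotient.mk_smul, Submodule.Quotient.mk_eq_zero]
    exact ⟨t, ht, a ^ t * r, Ideal.mul_mem_right _ _
      (mem_msetIdeal (Multiset.mem_map_of_mem _ ha)), by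
        rw [smul_comm, hy, map_mul, Algebra.smul_def]⟩
  · refine isArtinian_of_le (t := LinearMap.range f) fun h hh => ?_
    obtain ⟨y, rfl⟩ := Submodule.Quotient.mk_surjective _ h
    obtain ⟨t, ht, r, hy⟩ := exists_prod_pow_smul_eq s y
    obtain ⟨r', hr'⟩ := hR.exists_sub_prod_pow_mul_mem ht hs r fun a ha => by
      have := hh a ha
      rw [← Submodule.Quotient.mk_smul, Submodule.Quotient.mk_eq_zero] at this
      exact (hR.mem_cechBoundaries_iff hs ht (by
        rw [smul_comm, hy, map_mul, Algebra.smul_def])).1 this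
    refine ⟨Submodule.Quotient.mk r', ?_⟩
    change (cechBoundaries s).mkQ (r' • y₀) = _
    rw [Submodule.mkQ_apply, eq_comm, Submodule.Quotient.eq, hR.mem_cechBoundaries_iff hs ht _]
    · exact hr'
    · obtain ⟨k, rfl⟩ := Nat.exists_eq_succ_of_ne_zero ht
      have := hr₀ r'
      rw [pow_one] at this
      rw [smul_sub, hy, pow_succ, mul_smul _ _ (r' • y₀), this, map_sub, map_mul, Algebra.smul_def,
        Nat.succ_sub_one]

end TopLocalCohomology

section ITilde

variable {R : Type*} [CommRing R] (p : ℕ)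

/-- `J` is of the form `Ĩ(r)` where `I` is generated by powers of the elements of `s`. -/
def IsITildeOfPowers (s : Multiset R) (J : Ideal R) : Prop :=
  ∃ P : Multiset (R × ℕ), P.map Prod.fst = s ∧ (∀ q ∈ P, q.2 ≠ 0) ∧
    ∃ r, J = ITilde p (msetIdeal (P.map fun q => q.1 ^ q.2)) r

lemma isITildeOfPowers_iTilde (s : Multiset R) (r : R) :
    IsITildeOfPowers p s (ITilde p (msetIdeal s) r) :=
  ⟨s.map fun a => (a, 1), by simp, by simp, r, by simp⟩

variable [Fact p.Prime] [CharP R p]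

lemma mem_iTilde_msetIdeal {s : Multiset R} {x c : R} :
    c ∈ ITilde p (msetIdeal s) x ↔ ∀ e : ℕ, c * x ^ p ^ e ∈ msetIdeal (s.map (· ^ p ^ e)) := by
  rw [ITilde, Submodule.mem_iInf]
  refine forall_congr' fun e => ?_
  rw [bracketPow_msetIdeal, Ideal.mem_colon_span_singleton]

variable [IsLocalRing R]

lemma SopRegular.iTilde_cons_eq (hR : SopRegular R) {f c z : R} {w : Multiset R}
    (hz : IsSop (z ::ₘ w)) (hc : z - c * f ∈ msetIdeal w) (r : R) :
    ITilde p (msetIdeal (f ::ₘ w)) r = ITilde p (msetIdeal (z ::ₘ w)) (c * r) := by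
  ext d
  rw [mem_iTilde_msetIdeal, mem_iTilde_msetIdeal]
  refine forall_congr' fun e => ?_
  have hq : p ^ e ≠ 0 := pow_ne_zero _ (Fact.out : p.Prime).ne_zero
  have hz' := hz.map_pow hq
  rw [Multiset.map_cons] at hz'
  rw [Multiset.map_cons, Multiset.map_cons, mul_pow, mul_left_comm,
    hR.mul_mem_iff_cons_of_sub_mem hz']
  rw [← mul_pow, ← sub_pow_char_pow, ← bracketPow_msetIdeal, mul_comm f]
  exact Ideal.subset_span ⟨_, hc, rfl⟩

lemma IsITildeOfPowers.exchange (hR : SopRegular R) {J : Ideal R} {a b : R} {w : Multiset R}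
    (ha : IsSop (a ::ₘ w)) (hb : IsSop (b ::ₘ w)) (h : IsITildeOfPowers p (a ::ₘ w) J) :
    IsITildeOfPowers p (b ::ₘ w) J := by
  obtain ⟨P, hPs, hP, r, rfl⟩ := h
  obtain ⟨q, hq, rfl⟩ := Multiset.mem_map.1
    (show a ∈ P.map Prod.fst by rw [hPs]; exact Multiset.mem_cons_self a w)
  obtain ⟨P, rfl⟩ := Multiset.exists_cons_of_mem hq
  rw [Multiset.map_cons, Multiset.cons_inj_right] at hPs
  subst hPs
  have hP' : ∀ q ∈ P, q.2 ≠ 0 := fun q hq => hP q (Multiset.mem_cons_of_mem hq)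
  have h1 : IsSop (q.1 ^ q.2 ::ₘ P.map fun q => q.1 ^ q.2) := by
    rw [← Multiset.map_cons (fun q : R × ℕ => q.1 ^ q.2)]
    exact IsSop.map_pow' (by rwa [Multiset.map_cons]) hP
  have hpow : ∀ k ≠ 0, ∀ q' ∈ (b, k) ::ₘ P, q'.2 ≠ 0 := by
    intro k hk q' hq'
    rcases Multiset.mem_cons.1 hq' with rfl | hq'
    exacts [hk, hP' q' hq']
  obtain ⟨k, hk, c, hc⟩ := h1.exists_pow_sub_mem (hb.mem_maximalIdeal (Multiset.mem_cons_self b _))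
  have h2 : IsSop (b ^ k ::ₘ P.map fun q => q.1 ^ q.2) := by
    rw [← Multiset.map_cons (fun q : R × ℕ => q.1 ^ q.2) (b, k)]
    exact IsSop.map_pow' (by rwa [Multiset.map_cons]) (hpow k hk)
  refine ⟨(b, k) ::ₘ P, by rw [Multiset.map_cons], hpow k hk, c * r, ?_⟩
  rw [Multiset.map_cons, Multiset.map_cons]
  exact hR.iTilde_cons_eq p h2 hc r

lemma SopRegular.exists_iTilde_map_pow_eq (hR : SopRegular R) {s : Multiset R} (hs : IsSop s)
    {J : Ideal R} (h : IsITildeOfPowers p s J) :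
    ∃ t ≠ 0, ∃ r, J = ITilde p (msetIdeal (s.map (· ^ t))) r := by
  obtain ⟨P, rfl, hP, r, rfl⟩ := h
  set N := (P.map Prod.snd).sum + 1 with hN
  have hle : ∀ q ∈ P, q.2 ≤ N := fun q hq =>
    (Multiset.le_sum_of_mem (Multiset.mem_map_of_mem _ hq)).trans (Nat.le_succ _)
  refine ⟨N, by simp [hN], (P.map fun q => q.1 ^ (N - q.2)).prod * r, ?_⟩
  ext c
  rw [mem_iTilde_msetIdeal, mem_iTilde_msetIdeal]
  refine forall_congr' fun e => ?_
  have hq0 : p ^ e ≠ 0 := pow_ne_zero _ (Fact.out : p.Prime).ne_zero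
  let Q : Multiset (R × R) := P.map fun q => ((q.1 ^ q.2) ^ p ^ e, (q.1 ^ (N - q.2)) ^ p ^ e)
  have hmul : Q.map (fun q => q.1 * q.2) = ((P.map Prod.fst).map (· ^ N)).map (· ^ p ^ e) := by
    simp only [Q, Multiset.map_map]
    refine Multiset.map_congr rfl fun q hq => ?_
    simp only [Function.comp_apply]
    rw [← mul_pow, ← pow_add, Nat.add_sub_cancel' (hle q hq)]
  have hfst : Q.map Prod.fst = (P.map fun q => q.1 ^ q.2).map (· ^ p ^ e) := by
    simp only [Q, Multiset.map_map, Function.comp_def]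
  have hsnd : (Q.map Prod.snd).prod = (P.map fun q => q.1 ^ (N - q.2)).prod ^ p ^ e := by
    simp only [Q, Multiset.map_map, Function.comp_def, Multiset.prod_map_pow]
  rw [mul_pow, mul_left_comm, ← hmul, ← hfst, ← hsnd, hR.prod_mul_mem_iff]
  · simp only [Q, Multiset.mem_map]
    rintro _ ⟨q, hq, rfl⟩
    exact Ideal.pow_mem_of_mem _ (Ideal.pow_mem_of_mem _
      (hs.mem_maximalIdeal (Multiset.mem_map_of_mem _ hq)) _ (Nat.pos_of_ne_zero (hP q hq))) _
      (Nat.pos_of_ne_zero hq0)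
  · rw [hmul]
    exact (hs.map_pow (by simp [hN])).map_pow hq0

lemma SopRegular.iTilde_mem_specialPrimes (hR : SopRegular R) {s : Multiset R} (hs : IsSop s)
    {t : ℕ} (ht : t ≠ 0) (r : R) (hJ : (ITilde p (msetIdeal (s.map (· ^ t))) r).IsPrime) :
    ITilde p (msetIdeal (s.map (· ^ t))) r ∈ specialPrimes R (cechFrobenius p s) := by
  obtain ⟨y, hy⟩ := exists_smul_eq_algebraMap s t r
  let η : ℕ → Localization.Away s.prod ⧸ cechBoundaries s :=
    fun e => (cechFrobenius p s)^[e] (Submodule.Quotient.mk y)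
  refine ⟨hJ, Submodule.span R (Set.range η), fun h hh => ?_, ?_⟩
  · induction hh using Submodule.span_induction with
    | mem h hh =>
      obtain ⟨e, rfl⟩ := hh
      exact Submodule.subset_span ⟨e + 1, Function.iterate_succ_apply' _ _ _⟩
    | zero => rw [map_zero]; exact zero_mem _
    | add h h' _ _ ih ih' => rw [map_add]; exact add_mem ih ih'
    | smul c h _ ih => rw [cechFrobenius_smul]; exact Submodule.smul_mem _ _ ih
  · ext c
    rw [Submodule.mem_annihilator_span, mem_iTilde_msetIdeal, Subtype.forall]
    simp only [Set.forall_mem_range]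
    refine forall_congr' fun e => ?_
    rw [hR.smul_iterate_cechFrobenius_eq_zero_iff p hs ht hy, map_pow_mul_eq]

lemma isSop_coe_ofFn {n : ℕ} {x : Fin n → R} (hn : ringKrullDim R = n)
    (hx : (Ideal.span (Set.range x)).radical = IsLocalRing.maximalIdeal R) :
    IsSop (List.ofFn x : Multiset R) ∧
      msetIdeal (List.ofFn x : Multiset R) = Ideal.span (Set.range x) := by
  have h : msetIdeal (List.ofFn x : Multiset R) = Ideal.span (Set.range x) := by
    rw [msetIdeal]
    congr 1
    ext a
    simp [List.mem_ofFn]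
  exact ⟨⟨by rw [Multiset.coe_card, List.length_ofFn, hn], by rwa [h]⟩, h⟩

end ITilde

/-- Let `(R, 𝔪)` be a Cohen–Macaulay Noetherian local ring of prime characteristic `p` in
which every parameter ideal is Frobenius closed.  Then the set
`B(R) = {P ∈ Spec R : P = I(x) for some parameter ideal I and some x ∈ R}` is finite. -/
theorem bSet_finite
    {R : Type*} [CommRing R] [IsLocalRing R] [IsNoetherianRing R]
    (p : ℕ) [Fact p.Prime] [CharP R p]
    (hCM : IsCohenMacaulayLocal R)
    (hfrob : ∀ J : Ideal R, IsParameterIdeal J → FrobeniusClosed p J) :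
    {P : Ideal R | P.IsPrime ∧
      ∃ (I : Ideal R) (x : R), IsParameterIdeal I ∧ P = ITilde p I x}.Finite := by
  obtain ⟨n, x, hn, hx, hreg⟩ := hCM
  obtain ⟨hs, -⟩ := isSop_coe_ofFn hn hx
  have hR : SopRegular R := fun _ _ _ h hr =>
    hs.mem_of_mul_mem hreg.toIsWeaklyRegular h hr
  have := hR.isArtinian_cech hs
  refine (finite_specialPrimes (cechFrobenius_smul p _) (Fact.out : p.Prime).two_le
    (hR.injective_cechFrobenius p hs hfrob)).subset ?_
  rintro P ⟨hP, I, r, ⟨n', x', hn', rfl, hx'⟩, rfl⟩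
  obtain ⟨hs', hI⟩ := isSop_coe_ofFn hn' hx'
  obtain ⟨t, ht, r', hr'⟩ := hR.exists_iTilde_map_pow_eq p hs
    (IsSop.exchange_induction
      (C := fun s => IsITildeOfPowers p s (ITilde p (Ideal.span (Set.range x')) r))
      (fun _ _ _ ha hb h => h.exchange p hR ha hb) hs' hs (hI ▸ isITildeOfPowers_iTilde p _ r))
  rw [hr'] at hP ⊢
  exact hR.iTilde_mem_specialPrimes p hs ht r' hP
end
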